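/- arXiv:1602.09052 — 3 statements merged into one kernel-verified Lean document; each statement's English description precedes it below -/
import Mathlib

section
/- Let t ≥ 4 and let G be a finite graph that excludes K_t as a minor. Then for every r ∈ ℕ, wcol_r(G) ≤ C(r+t−2, t−2)·(t−3)·(2r+1). -/
open SimpleGraph

variable {V : Type} [Fintype V]

/-- `G` contains the complete graph `K_t` as a minor: `t` pairwise disjoint
nonempty connected subgraphs, pairwise joined by an edge. -/
def HasKtMinor (G : SimpleGraph V) (t : ℕ) : Prop :=
  ∃ B : Fin t → Set V, (∀ i, (B i).Nonempty) ∧ (∀ i, (G.induce (B i)).Connected) ∧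
    (∀ i j, i ≠ j → Disjoint (B i) (B j)) ∧
    ∀ i j, i ≠ j → ∃ u ∈ B i, ∃ v ∈ B j, G.Adj u v


/-- The set of vertices weakly `r`-reachable from `v` with respect to `L`. -/
def WReach (G : SimpleGraph V) (L : LinearOrder V) (r : ℕ) (v : V) : Set V :=
  {u | ∃ p : G.Walk v u, p.IsPath ∧ p.length ≤ r ∧ ∀ w ∈ p.support, L.le u w}

/-- The weak `r`-colouring number. -/
noncomputable def wcol (G : SimpleGraph V) (r : ℕ) : ℕ :=
  sInf {k | ∃ L : LinearOrder V, ∀ v, (WReach G L r v).ncard ≤ k}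


/-- Decreasing reach. -/
inductive DReach (N : ℕ → ℕ → Prop) : ℕ → ℕ → ℕ → Prop
  | refl (n a : ℕ) : DReach N n a a
  | step (n a b c : ℕ) : N a b → DReach N n b c → DReach N (n+1) a c

theorem DReach.mono {N : ℕ → ℕ → Prop} {n a b : ℕ} (h : DReach N n a b) :
    ∀ m, n ≤ m → DReach N m a b := by
  induction h with
  | refl n a => intro m _; exact .refl _ _
  | step n a b c h1 _ ih =>
    intro m hm
    obtain ⟨m, rfl⟩ : ∃ k, m = k + 1 := ⟨m - 1, by omega⟩
    exact .step _ _ _ _ h1 (ih m (by omega))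

theorem DReach.le {N : ℕ → ℕ → Prop} (hlt : ∀ a j, N a j → j < a) {n a b : ℕ}
    (h : DReach N n a b) : b ≤ a := by
  induction h with
  | refl n a => exact le_rfl
  | step n a b c h1 _ ih => have := hlt _ _ h1; omega

theorem DReach.back {N : ℕ → ℕ → Prop} (hlt : ∀ a j, N a j → j < a)
    (htri : ∀ a j l, N a j → N a l → j < l → N l j) {m a' i : ℕ}
    (h : DReach N m a' i) : ∀ a, N a' a → i ≤ a → DReach N m a i := by
  induction h with
  | refl n a' => intro a h1 h2; have := hlt _ _ h1; omega
  | step n a' b i h1 h2 ih =>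
    intro a ha hi
    rcases lt_trichotomy a b with h | h | h
    · exact (ih a (htri _ _ _ ha h1 h) hi).mono _ (by omega)
    · subst h; exact h2.mono _ (by omega)
    · exact .step _ _ _ _ (htri _ _ _ h1 ha h) h2

/-- if q is a back neighbour of v, everything reachable beyond q sees q -/
theorem DReach.sees {N : ℕ → ℕ → Prop} (hlt : ∀ a j, N a j → j < a)
    (htri : ∀ a j l, N a j → N a l → j < l → N l j) {n v i q : ℕ}
    (h : DReach N n v i) (hq : N v q) (hi : q < i) : N i q := by
  induction h with
  | refl n a' => exact hq
  | step n a b i h1 h2 ih =>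
    have := h2.le hlt
    exact ih (htri _ _ _ hq h1 (by omega)) hi

/-- if q is the least back neighbour -/
theorem DReach.via {N : ℕ → ℕ → Prop} (hlt : ∀ a j, N a j → j < a)
    (htri : ∀ a j l, N a j → N a l → j < l → N l j) {n v i q b : ℕ}
    (h : DReach N n v i) (hq : N v q) (hmin : ∀ j, b ≤ j → N v j → q ≤ j)
    (hb : b ≤ i) (hi : i ≤ q) : 1 ≤ n ∧ DReach N (n-1) q i := by
  cases h with
  | refl => have := hlt _ _ hq; omega
  | step n v c i h1 h2 =>
    refine ⟨by omega, ?_⟩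
    have := h2.le hlt
    have h3 := hmin c (by omega) h1
    rcases h3.eq_or_lt with h | h
    · subst h; exact h2
    · exact h2.back hlt htri q (htri _ _ _ hq h1 h) hi

theorem DReach.count {N : ℕ → ℕ → Prop} (hlt : ∀ a j, N a j → j < a)
    (htri : ∀ a j l, N a j → N a l → j < l → N l j) :
    ∀ (s k r : ℕ), k + r = s → ∀ b v, b ≤ v →
    (∀ n i, b ≤ i → DReach N n v i → {j | b ≤ j ∧ N i j}.ncard ≤ k) →
    {i | b ≤ i ∧ DReach N r v i}.ncard ≤ (r + k).choose k := by
  intro s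
  induction s with
  | zero =>
    intro k r hs b v hbv _
    obtain ⟨rfl, rfl⟩ : k = 0 ∧ r = 0 := by omega
    have : {i | b ≤ i ∧ DReach N 0 v i} ⊆ {v} := by
      rintro i ⟨_, h⟩; cases h; rfl
    simpa using Set.ncard_le_ncard this
  | succ s ih =>
    intro k r hs b v hbv hdeg
    by_cases hne : ∃ j, b ≤ j ∧ N v j
    · classical
      let q := Nat.find hne
      have hq : b ≤ q ∧ N v q := Nat.find_spec hne
      have hmin : ∀ j, b ≤ j → N v j → q ≤ j := fun j h1 h2 => Nat.find_min' hne ⟨h1, h2⟩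
      have hqv := hlt _ _ hq.2
      have hfin : ∀ b i, {j | b ≤ j ∧ N i j}.Finite := fun b i =>
        (Set.finite_lt_nat i).subset fun j hj => hlt _ _ hj.2
      have hdeg' : ∀ n i, q + 1 ≤ i → DReach N n v i →
          {j | q + 1 ≤ j ∧ N i j}.ncard + 1 ≤ k := by
        intro n i hi hd
        have hN := hd.sees hlt htri hq.2 hi
        refine le_trans ?_ (hdeg n i (by omega) hd)
        rw [← Set.ncard_insert_of_notMem (a := q) (by simp) (hfin _ _)]
        apply Set.ncard_le_ncard _ (hfin _ _)
        rintro j (rfl | hj)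
        · exact ⟨hq.1, hN⟩
        · exact ⟨by have := hj.1; omega, hj.2⟩
      have hk : 1 ≤ k := by
        have := hdeg' 0 v hqv (.refl _ _); omega
      obtain ⟨k, rfl⟩ : ∃ k', k = k' + 1 := ⟨k - 1, by omega⟩
      have h1 := ih k r (by omega) (q+1) v hqv (fun n i h h' => by
        have := hdeg' n i h h'; omega)
      have hfin2 : ∀ b r v, {i | b ≤ i ∧ DReach N r v i}.Finite := fun b r v =>
        (Set.finite_le_nat v).subset fun j hj => hj.2.le hlt
      cases r with
      | zero =>
        have : {i | b ≤ i ∧ DReach N 0 v i} ⊆ {v} := by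
          rintro i ⟨_, h⟩; cases h; rfl
        simpa using Set.ncard_le_ncard this
      | succ r =>
        have h2 := ih (k+1) r (by omega) b q hq.1 (fun n i h h' =>
          hdeg (n+1) i h (.step _ _ _ _ hq.2 h'))
        have : {i | b ≤ i ∧ DReach N (r+1) v i} ⊆
          {i | q + 1 ≤ i ∧ DReach N (r+1) v i} ∪ {i | b ≤ i ∧ DReach N r q i} := by
          rintro i ⟨hi, hd⟩
          by_cases h : q + 1 ≤ i
          · exact Or.inl ⟨h, hd⟩
          · exact Or.inr ⟨hi, (hd.via hlt htri hq.2 hmin hi (by omega)).2⟩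
        have h3 := (Set.ncard_le_ncard this ((hfin2 _ _ _).union (hfin2 _ _ _))).trans
          (Set.ncard_union_le _ _)
        have h4 : (r + 1 + (k+1)).choose (k+1) = (r+1+k).choose k + (r + (k+1)).choose (k+1) := by
          rw [show r + 1 + (k+1) = (r+1+k) + 1 by ring, Nat.choose_succ_succ]
          congr 2; ring
        omega
    · have : {i | b ≤ i ∧ DReach N r v i} ⊆ {v} := by
        rintro i ⟨hi, h⟩
        cases h with
        | refl => rfl
        | step n _ c _ h1 h2 =>
          exact absurd ⟨c, hi.trans (h2.le hlt), h1⟩ hne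
      have h5 := Set.ncard_le_ncard this
      rw [Set.ncard_singleton] at h5
      exact h5.trans (Nat.choose_pos (by omega))

theorem geo_injOn (G' : SimpleGraph V) {a w : V} (p : G'.Walk a w) (hp : p.length = G'.dist a w) :
    Set.InjOn (G'.dist a) {x | x ∈ p.support} := by
  have key : ∀ i, i ≤ p.length → G'.dist a (p.getVert i) = i := by
    intro i hi
    have h1 := dist_le (p.take i)
    have h2 := dist_le (p.drop i)
    have h3 := (p.take i).reachable.dist_triangle_left w
    rw [Walk.take_length] at h1
    rw [Walk.drop_length] at h2
    omega
  intro x hx y hy hxy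
  obtain ⟨i, rfl, hi⟩ := Walk.mem_support_iff_exists_getVert.1 hx
  obtain ⟨j, rfl, hj⟩ := Walk.mem_support_iff_exists_getVert.1 hy
  rw [key i hi, key j hj] at hxy
  rw [hxy]

theorem geo_spread (G' : SimpleGraph V) {a w : V} (p : G'.Walk a w) (hp : p.length = G'.dist a w)
    (v : V) (r : ℕ) :
    {u | u ∈ p.support ∧ ∃ q : G'.Walk v u, q.length ≤ r}.ncard ≤ 2 * r + 1 := by
  have hc : ((Finset.Icc (G'.dist a v - r) (G'.dist a v + r) : Finset ℕ) : Set ℕ).ncard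
      ≤ 2 * r + 1 := by
    rw [Set.ncard_coe_finset, Nat.card_Icc]; omega
  refine le_trans (Set.ncard_le_ncard_of_injOn (G'.dist a) ?_ ?_ (Finset.finite_toSet _)) hc
  · classical
    rintro u ⟨hu, q, hq⟩
    have hau : G'.Reachable a u := ⟨p.takeUntil u hu⟩
    have h1 := hau.dist_triangle_left v
    have h2 := q.reachable.symm.dist_triangle_right a
    have h3 := q.reachable.dist_triangle_right a
    have h4 := dist_le q
    rw [SimpleGraph.dist_comm] at h4
    have h5 := dist_le q
    simp only [Finset.coe_Icc, Set.mem_Icc]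
    omega
  · exact (geo_injOn G' p hp).mono fun u hu => hu.1

theorem tree_piece (G' : SimpleGraph V) (a : V) (T : Finset V) (hT : T.Nonempty)
    (hr : ∀ w ∈ T, G'.Reachable a w) :
    ∃ H : Set V, a ∈ H ∧ (∀ w ∈ T, w ∈ H) ∧ (∀ x ∈ H, G'.Reachable a x) ∧
      (G'.induce H).Connected ∧
      ∀ v r, {u | u ∈ H ∧ ∃ q : G'.Walk v u, q.length ≤ r}.ncard ≤ T.card * (2 * r + 1) := by
  have h1 : ∀ w : T, ∃ p : G'.Walk a w, p.length = G'.dist a w := fun w =>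
    (hr w w.2).exists_walk_length_eq_dist
  choose p hp using h1
  obtain ⟨w0, hw0⟩ := hT
  refine ⟨⋃₀ Set.range (fun w : T => {x | x ∈ (p w).support}), ?_, ?_, ?_, ?_, ?_⟩
  · exact ⟨_, ⟨⟨w0, hw0⟩, rfl⟩, (p _).start_mem_support⟩
  · intro w hw
    exact ⟨_, ⟨⟨w, hw⟩, rfl⟩, (p ⟨w, hw⟩).end_mem_support⟩
  · rintro x ⟨_, ⟨w, rfl⟩, hx⟩
    classical
    exact ⟨(p w).takeUntil x hx⟩
  · apply induce_sUnion_connected_of_pairwise_not_disjoint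
    · exact ⟨_, ⟨⟨w0, hw0⟩, rfl⟩⟩
    · rintro _ _ ⟨w, rfl⟩ ⟨w', rfl⟩
      exact ⟨a, (p _).start_mem_support, (p _).start_mem_support⟩
    · rintro _ ⟨w, rfl⟩
      exact (p w).connected_induce_support
  · intro v r
    have : {u | u ∈ ⋃₀ Set.range (fun w : T => {x | x ∈ (p w).support}) ∧
        ∃ q : G'.Walk v u, q.length ≤ r} ⊆
        ⋃ w : T, {u | u ∈ (p w).support ∧ ∃ q : G'.Walk v u, q.length ≤ r} := by
      rintro u ⟨⟨_, ⟨w, rfl⟩, hx⟩, hq⟩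
      exact Set.mem_iUnion.2 ⟨w, hx, hq⟩
    refine (Set.ncard_le_ncard this (Set.toFinite _)).trans ?_
    have h2 : (⋃ w : T, {u | u ∈ (p w).support ∧ ∃ q : G'.Walk v u, q.length ≤ r}).ncard ≤
        ∑ w : T, {u | u ∈ (p w).support ∧ ∃ q : G'.Walk v u, q.length ≤ r}.ncard := by
      exact Set.ncard_iUnion_le_of_fintype _
    refine h2.trans ((Finset.sum_le_card_nsmul _ _ _ fun w _ => geo_spread G' (p w) (hp w) v r).trans ?_)
    simp

/-- The graph on the vertices of index at least `a`. -/
def Gr (G : SimpleGraph V) (idx : V → ℕ) (a : ℕ) : SimpleGraph V where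
  Adj x y := G.Adj x y ∧ a ≤ idx x ∧ a ≤ idx y
  symm := ⟨fun _ _ h => ⟨h.1.symm, h.2.2, h.2.1⟩⟩
  loopless := ⟨fun _ h => h.1.ne rfl⟩

theorem Gr_le (G : SimpleGraph V) (idx : V → ℕ) (a : ℕ) : Gr G idx a ≤ G := fun _ _ h => h.1

theorem Gr_reach_le {G : SimpleGraph V} {idx : V → ℕ} {a : ℕ} {x z : V}
    (h : (Gr G idx a).Reachable x z) (hx : a ≤ idx x) : a ≤ idx z := by
  obtain ⟨p⟩ := h
  induction p with
  | nil => exact hx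
  | cons h _ ih => exact ih h.2.2

/-- The block `j` is attached to the component of `x` at stage `a`. -/
def Att (G : SimpleGraph V) (idx : V → ℕ) (a : ℕ) (x : V) (j : ℕ) : Prop :=
  j < a ∧ ∃ z y, (Gr G idx a).Reachable x z ∧ G.Adj z y ∧ idx y = j

theorem Att.trans {G : SimpleGraph V} {idx : V → ℕ} {a : ℕ} {x x' : V} {j : ℕ}
    (h : Att G idx a x j) (hx : (Gr G idx a).Reachable x' x) : Att G idx a x' j := by
  obtain ⟨h1, z, y, h2, h3⟩ := h
  exact ⟨h1, z, y, hx.trans h2, h3⟩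

/-- Invariant of the construction. -/
structure DInv (G : SimpleGraph V) (idx : V → ℕ) (t r n : ℕ) : Prop where
  clique : ∀ a ≤ n, ∀ x, a ≤ idx x → ∀ j l, Att G idx a x j → Att G idx a x l → j ≠ l →
    ∃ y y', idx y = j ∧ idx y' = l ∧ G.Adj y y'
  conn : ∀ a < n, (G.induce {x | idx x = a}).Connected
  spread : ∀ a < n, ∀ v, {u | idx u = a ∧ ∃ q : (Gr G idx a).Walk v u, q.length ≤ r}.ncard
    ≤ (t - 3) * (2 * r + 1)

theorem DInv.reach {G : SimpleGraph V} {idx : V → ℕ} {t r n : ℕ} (h : DInv G idx t r n)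
    {a : ℕ} (ha : a < n) {x y : V} (hx : idx x = a) (hy : idx y = a) :
    (Gr G idx a).Reachable x y := by
  have h1 := (h.conn a ha).preconnected ⟨x, hx⟩ ⟨y, hy⟩
  let f : G.induce {x | idx x = a} →g Gr G idx a :=
    ⟨Subtype.val, fun {u v} huv => ⟨huv, (show idx u.1 = a from u.2).ge, (show idx v.1 = a from v.2).ge⟩⟩
  exact h1.map f

theorem att_finite (G : SimpleGraph V) (idx : V → ℕ) (a : ℕ) (x : V) :
    {j | Att G idx a x j}.Finite := (Set.finite_lt_nat a).subset fun _ h => h.1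

theorem minor_of_card {G : SimpleGraph V} {ι : Type} [Fintype ι] {t : ℕ}
    (ht : t ≤ Fintype.card ι) (B : ι → Set V)
    (h2 : ∀ i, (G.induce (B i)).Connected)
    (h3 : ∀ i j, i ≠ j → Disjoint (B i) (B j))
    (h4 : ∀ i j, i ≠ j → ∃ u ∈ B i, ∃ v ∈ B j, G.Adj u v) : HasKtMinor G t := by
  obtain ⟨f⟩ : Nonempty (Fin t ↪ ι) := Function.Embedding.nonempty_of_card_le (by simpa using ht)
  refine ⟨fun i => B (f i), fun i => ?_, fun i => h2 _, fun i j hij => h3 _ _ (f.injective.ne hij),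
    fun i j hij => h4 _ _ (f.injective.ne hij)⟩
  obtain ⟨x⟩ := (h2 (f i)).nonempty
  exact ⟨x.1, x.2⟩

theorem DInv.card_att {G : SimpleGraph V} {idx : V → ℕ} {t r n : ℕ} (h : DInv G idx t r n)
    (ht : 4 ≤ t) (hG : ¬ HasKtMinor G t) {a : ℕ} (ha : a ≤ n) {x : V} (hx : a ≤ idx x) :
    {j | Att G idx a x j}.ncard ≤ t - 2 := by
  by_contra hcon
  apply hG
  have := (att_finite G idx a x).fintype
  let B : Option {j | Att G idx a x j} → Set V := fun o => match o with
    | none => ((Gr G idx a).connectedComponentMk x).supp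
    | some j => {y | idx y = j.1}
  have hnone : ∀ z, z ∈ B none ↔ (Gr G idx a).Reachable x z := fun z => by
    show z ∈ ((Gr G idx a).connectedComponentMk x).supp ↔ _
    rw [ConnectedComponent.mem_supp_iff, ConnectedComponent.eq]
    exact ⟨fun h => h.symm, fun h => h.symm⟩
  have hd : ∀ j : {j | Att G idx a x j}, Disjoint (B none) (B (some j)) := by
    intro j
    rw [Set.disjoint_left]
    intro z hz (hz2 : idx z = j.1)
    have h1 := Gr_reach_le ((hnone z).1 hz) hx
    have h2 := j.2.1
    omega
  have hadj : ∀ j : {j | Att G idx a x j}, ∃ u ∈ B none, ∃ v ∈ B (some j), G.Adj u v := by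
    intro j
    obtain ⟨_, z, y, h1, h2, h3⟩ := j.2
    exact ⟨z, (hnone z).2 h1, y, h3, h2⟩
  refine minor_of_card (ι := Option {j | Att G idx a x j}) ?_ B ?_ ?_ ?_
  · rw [Fintype.card_option, ← Nat.card_eq_fintype_card, Nat.card_coe_set_eq]
    omega
  · rintro (_ | j)
    · have hc := ConnectedComponent.connected_toSimpleGraph ((Gr G idx a).connectedComponentMk x)
      have hle : (Gr G idx a).induce (B none) ≤ G.induce (B none) := fun u v huv =>
        Gr_le G idx a huv
      exact Connected.mono hle hc
    · exact h.conn j.1 (lt_of_lt_of_le j.2.1 ha)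
  · rintro (_ | j) (_ | l) hij
    · exact absurd rfl hij
    · exact hd l
    · exact (hd j).symm
    · rw [Set.disjoint_left]
      intro z (hz : idx z = j.1) (hz2 : idx z = l.1)
      exact hij (congrArg some (Subtype.ext (hz.symm.trans hz2)))
  · rintro (_ | j) (_ | l) hij
    · exact absurd rfl hij
    · exact hadj l
    · obtain ⟨u, hu, v, hv, huv⟩ := hadj j
      exact ⟨v, hv, u, hu, huv.symm⟩
    · obtain ⟨y, y', h1, h2, h3⟩ := h.clique a ha x hx j.1 l.1 j.2 l.2
        (fun h => hij (congrArg some (Subtype.ext h)))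
      exact ⟨y, h1, y', h2, h3⟩

theorem DInv.targets {G : SimpleGraph V} {idx : V → ℕ} {t r n : ℕ} (h : DInv G idx t r n)
    (ht : 4 ≤ t) (hG : ¬ HasKtMinor G t) {x : V} (hx : n ≤ idx x) :
    ∃ (a : V) (T : Finset V), T.Nonempty ∧ T.card ≤ t - 3 ∧ (Gr G idx n).Reachable x a ∧
      (∀ w ∈ T, (Gr G idx n).Reachable x w) ∧
      ∀ j, Att G idx n x j → ∃ z y, (z = a ∨ z ∈ T) ∧ G.Adj z y ∧ idx y = j := by
  classical
  have hcard := h.card_att ht hG le_rfl hx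
  have hfin := att_finite G idx n x
  by_cases hne : ∃ j, Att G idx n x j
  · obtain ⟨j1, hj1⟩ := hne
    have : Nonempty V := ⟨x⟩
    have h1 : ∀ j, Att G idx n x j →
      ∃ z, (Gr G idx n).Reachable x z ∧ ∃ y, G.Adj z y ∧ idx y = j := by
      rintro j ⟨_, z, y, h1, h2⟩
      exact ⟨z, h1, y, h2⟩
    choose! w hw1 hw2 using h1
    let T0 := (hfin.toFinset.erase j1).image w
    have hT0 : T0.card ≤ t - 3 := by
      refine Finset.card_image_le.trans ?_
      rw [Finset.card_erase_of_mem (by simpa using hj1), ← Set.ncard_eq_toFinset_card _ hfin]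
      omega
    have hreach : ∀ z ∈ T0, (Gr G idx n).Reachable x z := by
      intro z hz
      simp only [T0, Finset.mem_image, Finset.mem_erase, Set.Finite.mem_toFinset] at hz
      obtain ⟨j, hj, rfl⟩ := hz
      exact hw1 j hj.2
    have hcov : ∀ j, Att G idx n x j → w j = w j1 ∨ w j ∈ T0 := by
      intro j hj
      by_cases hjj : j = j1
      · left; rw [hjj]
      · right
        exact Finset.mem_image_of_mem _ (by simpa using ⟨hjj, hj⟩)
    by_cases hT : T0.Nonempty
    · refine ⟨w j1, T0, hT, hT0, hw1 _ hj1, hreach, fun j hj => ?_⟩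
      obtain ⟨y, hy⟩ := hw2 j hj
      exact ⟨w j, y, hcov j hj, hy⟩
    · refine ⟨w j1, {w j1}, by simp, by simp; omega, hw1 _ hj1, ?_, fun j hj => ?_⟩
      · simpa using hw1 _ hj1
      · obtain ⟨y, hy⟩ := hw2 j hj
        refine ⟨w j, y, ?_, hy⟩
        rcases hcov j hj with h | h
        · exact Or.inl h
        · exact absurd ⟨_, h⟩ hT
  · exact ⟨x, {x}, by simp, by simp; omega, Reachable.refl _, by simp, fun j hj => absurd ⟨j, hj⟩ hne⟩

theorem DInv.step {G : SimpleGraph V} {idx : V → ℕ} {t r n : ℕ} (h : DInv G idx t r n)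
    (ht : 4 ≤ t) (hG : ¬ HasKtMinor G t) (hidx : ∀ x, idx x ≤ n) {x0 : V} (hx0 : idx x0 = n) :
    ∃ idx' : V → ℕ, DInv G idx' t r (n+1) ∧ (∀ x, idx' x ≤ n + 1) ∧
      {x | idx' x = n + 1}.ncard < {x | idx x = n}.ncard := by
  classical
  obtain ⟨a, T, hT, hTc, hxa, hTr, hTatt⟩ := h.targets ht hG hx0.ge
  obtain ⟨H, haH, hTH, hHr, hHc, hHs⟩ := tree_piece (Gr G idx n) a T hT
    (fun w hw => hxa.symm.trans (hTr w hw))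
  have hHn : ∀ x ∈ H, idx x = n := fun x hx =>
    le_antisymm (hidx x) (Gr_reach_le (hxa.trans (hHr x hx)) hx0.ge)
  let idx' : V → ℕ := fun x => if x ∈ H then n else if idx x = n then n + 1 else idx x
  have hlt : ∀ a < n, ∀ x, idx' x = a ↔ idx x = a := by
    intro a ha x
    have := hHn x
    simp only [idx']
    split_ifs with h1 h2
    · have := this h1; omega
    · omega
    · rfl
  have hge : ∀ a ≤ n, ∀ x, a ≤ idx' x ↔ a ≤ idx x := by
    intro a ha x
    have := hHn x
    simp only [idx']
    split_ifs with h1 h2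
    · have := this h1; omega
    · omega
    · rfl
  have heq : ∀ x, idx' x = n ↔ x ∈ H := by
    intro x
    simp only [idx']
    split_ifs with h1 h2
    · simp [h1]
    · simp [h1]
    · simp [h1, h2]
  have htop : ∀ x, n + 1 ≤ idx' x ↔ idx x = n ∧ x ∉ H := by
    intro x
    have := hidx x
    simp only [idx']
    split_ifs with h1 h2
    · simp [h1]
    · simp [h1, h2]
    · simp only [h2, false_and, iff_false]; omega
  have hGr : ∀ a ≤ n, Gr G idx' a = Gr G idx a := by
    intro a ha
    ext x y
    simp only [Gr, hge a ha]
  have hAtt : ∀ a ≤ n, ∀ x j, Att G idx' a x j ↔ Att G idx a x j := by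
    intro a ha x j
    unfold Att
    rw [hGr a ha]
    refine and_congr_right fun hj => ?_
    simp only [hlt j (lt_of_lt_of_le hj ha)]
  have hle : Gr G idx' (n+1) ≤ Gr G idx n := by
    rw [← hGr n le_rfl]
    intro u v huv
    exact ⟨huv.1, by have := huv.2.1; omega, by have := huv.2.2; omega⟩
  have htouch : ∀ j, Att G idx n a j → ∃ z ∈ H, ∃ y, G.Adj z y ∧ idx y = j := by
    intro j hj
    obtain ⟨z, y, hz, hzy⟩ := hTatt j (hj.trans hxa)
    refine ⟨z, ?_, y, hzy⟩
    rcases hz with rfl | hz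
    · exact haH
    · exact hTH z hz
  -- attachments at stage n+1
  have hAtt1 : ∀ x j, Att G idx' (n+1) x j → j < n → Att G idx n x j := by
    rintro x j ⟨_, z, y, h1, h2, h3⟩ hj
    exact ⟨hj, z, y, h1.mono hle, h2, (hlt j hj y).1 h3⟩
  have hAtt2 : ∀ x, n + 1 ≤ idx' x → Att G idx' (n+1) x n → (Gr G idx n).Reachable a x := by
    rintro x hx ⟨_, z, y, h1, h2, h3⟩
    have hz := ((htop z).1 (Gr_reach_le h1 hx)).1
    have hy := (heq y).1 h3
    have hadj : (Gr G idx n).Adj y z := ⟨h2.symm, (hHn y hy).ge, hz.ge⟩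
    exact (hHr y hy).trans (hadj.reachable.trans (h1.mono hle).symm)
  refine ⟨idx', ⟨?_, ?_, ?_⟩, ?_, ?_⟩
  · intro b hb x hx j l hj hl hjl
    by_cases hbn : b ≤ n
    · rw [hAtt b hbn] at hj hl
      obtain ⟨y, y', h1, h2, h3⟩ := h.clique b hbn x ((hge b hbn x).1 hx) j l hj hl hjl
      exact ⟨y, y', (hlt j (lt_of_lt_of_le hj.1 hbn) y).2 h1,
        (hlt l (lt_of_lt_of_le hl.1 hbn) y').2 h2, h3⟩
    · obtain rfl : b = n + 1 := by omega
      have hjn := hj.1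
      have hln := hl.1
      have key : ∀ j, j < n → Att G idx' (n+1) x j → Att G idx' (n+1) x n →
          ∃ z y, idx' z = n ∧ idx' y = j ∧ G.Adj z y := by
        intro j hjn hj hn
        obtain ⟨z, hz, y, hzy, hy⟩ := htouch j ((hAtt1 x j hj hjn).trans (hAtt2 x hx hn))
        exact ⟨z, y, (heq z).2 hz, (hlt j hjn y).2 hy, hzy⟩
      by_cases hj' : j = n
      · subst hj'
        exact key l (by omega) hl hj
      · by_cases hl' : l = n
        · subst hl'
          obtain ⟨z, y, h1, h2, h3⟩ := key j (by omega) hj hl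
          exact ⟨y, z, h2, h1, h3.symm⟩
        · obtain ⟨y, y', h1, h2, h3⟩ := h.clique n le_rfl x ((htop x).1 hx).1.ge j l
            (hAtt1 x j hj (by omega)) (hAtt1 x l hl (by omega)) hjl
          exact ⟨y, y', (hlt j (by omega) y).2 h1, (hlt l (by omega) y').2 h2, h3⟩
  · intro b hb
    by_cases hbn : b < n
    · have : {x | idx' x = b} = {x | idx x = b} := by ext x; exact hlt b hbn x
      rw [this]; exact h.conn b hbn
    · obtain rfl : b = n := by omega
      have : {x | idx' x = b} = H := by ext x; exact heq x
      rw [this]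
      have hle : (Gr G idx b).induce H ≤ G.induce H := fun u v huv => Gr_le G idx b huv
      exact Connected.mono hle hHc
  · intro b hb v
    by_cases hbn : b < n
    · rw [hGr b hbn.le]
      simp only [hlt b hbn]
      exact h.spread b hbn v
    · obtain rfl : b = n := by omega
      rw [hGr b le_rfl]
      simp only [heq]
      exact (hHs v r).trans (Nat.mul_le_mul_right _ hTc)
  · intro x
    have := hidx x
    simp only [idx']
    split_ifs <;> omega
  · apply Set.ncard_lt_ncard _ (Set.toFinite _)
    refine ⟨fun x hx => ((htop x).1 (le_of_eq (Eq.symm hx))).1, fun hsub => ?_⟩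
    have h1 : idx' a = n + 1 := hsub (hHn a haH)
    have h2 := (heq a).2 haH
    omega

theorem DInv.exists_final {G : SimpleGraph V} {t r : ℕ} (ht : 4 ≤ t) (hG : ¬ HasKtMinor G t) :
    ∃ (n : ℕ) (idx : V → ℕ), DInv G idx t r n ∧ ∀ x, idx x < n := by
  have key : ∀ (m n : ℕ) (idx : V → ℕ), DInv G idx t r n → (∀ x, idx x ≤ n) →
      {x | idx x = n}.ncard ≤ m → ∃ (n : ℕ) (idx : V → ℕ), DInv G idx t r n ∧ ∀ x, idx x < n := by
    intro m
    induction m with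
    | zero =>
      intro n idx h hidx hm
      refine ⟨n, idx, h, fun x => lt_of_le_of_ne (hidx x) fun hx => ?_⟩
      have h1 := (Set.ncard_eq_zero (Set.toFinite _)).1 (Nat.le_zero.1 hm)
      have h2 : x ∈ {x | idx x = n} := hx
      rw [h1] at h2
      exact h2
    | succ m ih =>
      intro n idx h hidx hm
      by_cases hex : ∃ x0, idx x0 = n
      · obtain ⟨x0, hx0⟩ := hex
        obtain ⟨idx', h1, h2, h3⟩ := h.step ht hG hidx hx0
        exact ih (n+1) idx' h1 h2 (by omega)
      · exact ⟨n, idx, h, fun x => lt_of_le_of_ne (hidx x) fun hx => hex ⟨x, hx⟩⟩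
  refine key _ 0 (fun _ => 0) ⟨?_, ?_, ?_⟩ (fun _ => le_rfl) le_rfl
  · intro a ha x _ j l hj
    have := hj.1; omega
  · intro a ha; omega
  · intro a ha; omega

/-- Back neighbours of a block. -/
def BackN (G : SimpleGraph V) (idx : V → ℕ) (a j : ℕ) : Prop :=
  ∃ x, idx x = a ∧ Att G idx a x j

theorem dreach_of_walk {G : SimpleGraph V} {idx : V → ℕ}
    (htri : ∀ a j l, BackN G idx a j → BackN G idx a l → j < l → BackN G idx l j)
    {v u : V} (p : G.Walk v u) (hp : ∀ w ∈ p.support, idx u ≤ idx w) :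
    DReach (BackN G idx) p.length (idx v) (idx u) ∧
    ∃ q : (Gr G idx (idx u)).Walk v u, q.length ≤ p.length := by
  have hlt : ∀ a j, BackN G idx a j → j < a := fun a j ⟨_, _, h⟩ => h.1
  have hadjN : ∀ x y, G.Adj x y → idx y < idx x → BackN G idx (idx x) (idx y) := fun x y h h' =>
    ⟨x, rfl, h', x, y, Reachable.refl _, h, rfl⟩
  induction p with
  | nil => exact ⟨.refl _ _, Walk.nil, le_rfl⟩
  | @cons v v' u hadj p ih =>
    obtain ⟨h1, q, hq⟩ := ih (fun w hw => hp w (by simp [hw]))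
    have hv := hp v (by simp)
    have hv' := hp v' (by simp)
    have hA : (Gr G idx (idx u)).Adj v v' := ⟨hadj, hv, hv'⟩
    refine ⟨?_, Walk.cons hA q, by rw [Walk.length_cons, Walk.length_cons]; omega⟩
    rw [Walk.length_cons]
    rcases lt_trichotomy (idx v) (idx v') with h | h | h
    · exact (h1.back hlt htri _ (hadjN _ _ hadj.symm h) hv).mono _ (by omega)
    · rw [h]; exact h1.mono _ (by omega)
    · exact .step _ _ _ _ (hadjN _ _ hadj h) h1

/-- **Theorem.** For `t ≥ 4`, every graph excluding `K_t` as a minor satisfies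
`wcol_r(G) ≤ C(r+t−2, t−2)·(t−3)·(2r+1)`. -/
theorem wcol_le_of_Kt_minor_free (t : ℕ) (ht : 4 ≤ t)
    (G : SimpleGraph V) (hG : ¬ HasKtMinor G t) (r : ℕ) :
    wcol G r ≤ (r + t - 2).choose (t - 2) * ((t - 3) * (2 * r + 1)) := by
  classical
  obtain ⟨n, idx, h, hn⟩ := DInv.exists_final (r := r) ht hG
  have hlt : ∀ a j, BackN G idx a j → j < a := fun a j ⟨_, _, h⟩ => h.1
  have htri : ∀ a j l, BackN G idx a j → BackN G idx a l → j < l → BackN G idx l j := by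
    rintro a j l ⟨x, hx, hj⟩ ⟨x', hx', hl⟩ hjl
    have han : a < n := hx ▸ hn x
    obtain ⟨y, y', h1, h2, h3⟩ := h.clique a han.le x hx.ge j l hj
      (hl.trans (h.reach han hx hx')) hjl.ne
    exact ⟨y', h2, hjl, y', y, Reachable.refl _, h3.symm, h1⟩
  have hdeg : ∀ a, {j | BackN G idx a j}.ncard ≤ t - 2 := by
    intro a
    by_cases hex : ∃ x, idx x = a
    · obtain ⟨x, hx⟩ := hex
      have han : a < n := hx ▸ hn x
      refine le_trans (Set.ncard_le_ncard ?_ (att_finite G idx a x)) (h.card_att ht hG han.le hx.ge)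
      rintro j ⟨x', hx', hj⟩
      exact hj.trans (h.reach han hx hx')
    · have : {j | BackN G idx a j} = ∅ := by
        ext j
        simp only [Set.mem_setOf_eq, Set.mem_empty_iff_false, iff_false]
        rintro ⟨x, hx, _⟩
        exact hex ⟨x, hx⟩
      simp [this]
  apply Nat.sInf_le
  let e := Fintype.equivFin V
  let f : V → ℕ ×ₗ Fin (Fintype.card V) := fun x => toLex (idx x, e x)
  have hf : Function.Injective f := by
    intro x y hxy
    have := congrArg (fun z => (ofLex z).2) hxy
    exact e.injective this
  refine ⟨LinearOrder.lift' f hf, fun v => ?_⟩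
  have hL : ∀ x y, (LinearOrder.lift' f hf).le x y → idx x ≤ idx y := by
    intro x y hxy
    have h1 : f x ≤ f y := hxy
    rw [Prod.Lex.le_iff] at h1
    rcases h1 with h1 | h1
    · exact le_of_lt h1
    · exact le_of_eq h1.1
  have hDfin : {i | 0 ≤ i ∧ DReach (BackN G idx) r (idx v) i}.Finite :=
    (Set.finite_le_nat (idx v)).subset fun j hj => hj.2.le hlt
  have hcount := DReach.count hlt htri _ (t-2) r rfl 0 (idx v) (Nat.zero_le _)
    (fun n i _ _ => by simpa using hdeg i)
  have hsub : WReach G (LinearOrder.lift' f hf) r v ⊆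
      ⋃ i ∈ hDfin.toFinset, {u | idx u = i ∧ ∃ q : (Gr G idx i).Walk v u, q.length ≤ r} := by
    rintro u ⟨p, _, hpl, hp⟩
    obtain ⟨h1, q, hq⟩ := dreach_of_walk htri p (fun w hw => hL _ _ (hp w hw))
    simp only [Set.mem_iUnion]
    refine ⟨idx u, ?_, rfl, q, hq.trans hpl⟩
    rw [Set.Finite.mem_toFinset]
    exact ⟨Nat.zero_le _, h1.mono _ hpl⟩
  refine (Set.ncard_le_ncard hsub (Set.toFinite _)).trans ?_
  refine (Finset.set_ncard_biUnion_le _ _).trans ?_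
  refine (Finset.sum_le_card_nsmul _ _ ((t - 3) * (2 * r + 1)) ?_).trans ?_
  · intro i _
    by_cases hi : i < n
    · exact h.spread i hi v
    · have : {u | idx u = i ∧ ∃ q : (Gr G idx i).Walk v u, q.length ≤ r} = ∅ := by
        ext u
        simp only [Set.mem_setOf_eq, Set.mem_empty_iff_false, iff_false]
        rintro ⟨hu, _⟩
        have := hn u
        omega
      simp [this]
  · rw [smul_eq_mul, ← Set.ncard_eq_toFinset_card _ hDfin]
    apply Nat.mul_le_mul_right
    rw [show r + t - 2 = r + (t - 2) by omega]
    exact hcount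
end

section
/- For every t ≥ 3 and every finite graph G that excludes K_t as a minor, and every r ∈ ℕ, col_r(G) ≤ C(t−1, 2)·(2r+1). -/
open SimpleGraph

variable {V : Type} [Fintype V]

/-- The set of vertices strongly `r`-reachable from `v` with respect to `L`. -/
def SReach (G : SimpleGraph V) (L : LinearOrder V) (r : ℕ) (v : V) : Set V :=
  {u | ∃ p : G.Walk v u, p.IsPath ∧ p.length ≤ r ∧ L.le u v ∧
    ∀ w ∈ p.support, w ≠ u → w ≠ v → L.lt v w}

/-- The `r`-colouring number. -/
noncomputable def col (G : SimpleGraph V) (r : ℕ) : ℕ :=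
  sInf {k | ∃ L : LinearOrder V, ∀ v, (SReach G L r v).ncard ≤ k}


set_option linter.unusedSectionVars false
set_option linter.unusedVariables false

namespace KtCol

/-- step-bounded reachability where all vertices but the last are in `C` -/
def Rch (G : SimpleGraph V) (C : Set V) : ℕ → V → V → Prop
  | 0, v, u => v = u
  | n + 1, v, u => v = u ∨ (v ∈ C ∧ ∃ w, G.Adj v w ∧ Rch G C n w u)

lemma Rch.mono {G : SimpleGraph V} {C D : Set V} (h : C ⊆ D) :
    ∀ {n : ℕ} {v u : V}, Rch G C n v u → Rch G D n v u
  | 0, _, _, hr => hr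
  | _ + 1, _, _, Or.inl hr => Or.inl hr
  | _ + 1, _, _, Or.inr ⟨hv, w, hw, hr⟩ => Or.inr ⟨h hv, w, hw, Rch.mono h hr⟩

/-- neighbourhood of a set -/
def Nb (G : SimpleGraph V) (C : Set V) : Set V := {z | z ∉ C ∧ ∃ c ∈ C, G.Adj z c}

lemma Rch.mem_nb {G : SimpleGraph V} {C : Set V} :
    ∀ {n : ℕ} {v u : V}, v ∈ C ∨ v ∈ Nb G C → Rch G C n v u → u ∈ C ∨ u ∈ Nb G C
  | 0, _, _, hv, hr => by cases hr; exact hv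
  | _ + 1, _, _, hv, Or.inl hr => by cases hr; exact hv
  | n + 1, v, u, _, Or.inr ⟨hvC, w, hw, hr⟩ => by
      refine Rch.mem_nb (n := n) (v := w) ?_ hr
      by_cases h : w ∈ C
      · exact Or.inl h
      · exact Or.inr ⟨h, v, hvC, hw.symm⟩

/-- if `X` is closed in `D` then reachability within `D` from `X` is within `X` -/
lemma Rch.restrict {G : SimpleGraph V} {D X : Set V}
    (hX : ∀ x ∈ X, ∀ y ∈ D, G.Adj x y → y ∈ X) :
    ∀ {n : ℕ} {v u : V}, (v ∈ D → v ∈ X) → Rch G D n v u → Rch G X n v u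
  | 0, _, _, _, hr => hr
  | _ + 1, _, _, _, Or.inl hr => Or.inl hr
  | n + 1, v, u, hv, Or.inr ⟨hvD, w, hw, hr⟩ =>
      Or.inr ⟨hv hvD, w, hw, Rch.restrict hX (fun h => hX v (hv hvD) w h hw) hr⟩

lemma Rch.of_walk {G : SimpleGraph V} {C : Set V} :
    ∀ {n : ℕ} {v u : V} (p : G.Walk v u), p.IsPath → p.length ≤ n →
      (∀ w ∈ p.support, w ≠ u → w ∈ C) → Rch G C n v u
  | 0, _, _, .nil, _, _, _ => rfl
  | _ + 1, _, _, .nil, _, _, _ => Or.inl rfl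
  | n + 1, v, u, .cons h q, hp, hl, hC => by
      rw [SimpleGraph.Walk.cons_isPath_iff] at hp
      refine Or.inr ⟨hC v (by simp) ?_, _, h, Rch.of_walk q hp.1 (by simpa using hl) ?_⟩
      · rintro rfl; exact hp.2 q.end_mem_support
      · intro w hw; exact hC w (by simp [hw])

def Flat (G : SimpleGraph V) (r : ℕ) (C S : Set V) : Prop :=
  ∀ v ∈ C, {u | u ∈ S ∧ Rch G C r v u}.ncard ≤ 2 * r + 1

lemma Flat.mono {G : SimpleGraph V} {r : ℕ} {C D S T : Set V} (h : Flat G r D T)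
    (hC : C ⊆ D) (hS : S ⊆ T) : Flat G r C S := by
  intro v hv
  have h1 : {u | u ∈ S ∧ Rch G C r v u} ⊆ {u | u ∈ T ∧ Rch G D r v u} :=
    fun _ hu => ⟨hS hu.1, hu.2.mono hC⟩
  exact (Set.ncard_le_ncard h1 (Set.toFinite _)).trans (h v (hC hv))

lemma flat_pair {G : SimpleGraph V} {r : ℕ} (hr : 1 ≤ r) (C : Set V) (x y : V) :
    Flat G r C (∅ ∪ {x, y}) := fun v _ => by
  have h1 : {u | u ∈ (∅ ∪ {x, y} : Set V) ∧ Rch G C r v u}.ncard ≤ ({x, y} : Set V).ncard :=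
    Set.ncard_le_ncard (fun u hu => by simpa using hu.1) (Set.toFinite _)
  have h2 := Set.ncard_insert_le x {y}
  rw [Set.ncard_singleton] at h2
  omega

/-- `M` is the interior of a path from `x` to `y` -/
def LP (G : SimpleGraph V) (x : V) (M : Set V) (y : V) : Prop :=
  ∃ l : List V, l.Nodup ∧ (∀ w, w ∈ M ↔ w ∈ l) ∧ (x :: (l ++ [y])).IsChain G.Adj

lemma LP.symm {G : SimpleGraph V} {x y : V} {M : Set V} (h : LP G x M y) : LP G y M x := by
  obtain ⟨l, h1, h2, h3⟩ := h
  refine ⟨l.reverse, by simpa using h1, by simpa using h2, ?_⟩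
  have : (y :: (l.reverse ++ [x])) = (x :: (l ++ [y])).reverse := by simp
  rw [this, List.isChain_reverse]
  exact h3.imp fun _ _ h => h.symm

lemma conn_chain {G : SimpleGraph V} : ∀ (l : List V) (U : Set V) (x : V), x ∈ U →
    (G.induce U).Connected → (x :: l).IsChain G.Adj → (G.induce (U ∪ {w | w ∈ l})).Connected
  | [], U, x, _, hU, _ => by
      have : U ∪ {w | w ∈ ([] : List V)} = U := by ext; simp
      rw [this]; exact hU
  | z :: l, U, x, hx, hU, hc => by
      rw [List.isChain_cons_cons] at hc
      have h1 : (G.induce (U ∪ {x, z})).Connected :=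
        SimpleGraph.induce_union_connected hU.preconnected
          (SimpleGraph.induce_pair_connected_of_adj hc.1).preconnected ⟨x, hx, by simp⟩
      have h2 := conn_chain l (U ∪ {x, z}) z (by simp) h1 hc.2
      have : U ∪ {w | w ∈ z :: l} = U ∪ {x, z} ∪ {w | w ∈ l} := by
        ext w; simp; grind
      rw [this]; exact h2

lemma LP.conn {G : SimpleGraph V} {x y : V} {M U : Set V} (h : LP G x M y) (hx : x ∈ U)
    (hU : (G.induce U).Connected) : (G.induce (U ∪ M)).Connected := by
  obtain ⟨l, _, h2, h3⟩ := h
  have : M = {w | w ∈ l} := Set.ext h2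
  rw [this]
  refine conn_chain l U x hx hU ?_
  rw [← List.cons_append] at h3
  exact h3.left_of_append

lemma LP.adj {G : SimpleGraph V} {x y : V} {M : Set V} (h : LP G x M y) :
    ∃ u ∈ insert x M, G.Adj u y := by
  obtain ⟨l, _, h2, h3⟩ := h
  rcases List.eq_nil_or_concat l with rfl | ⟨l', z, rfl⟩
  · exact ⟨x, by simp, by simpa using h3⟩
  · refine ⟨z, Or.inr ((h2 z).2 (by simp)), ?_⟩
    have : x :: (l'.concat z ++ [y]) = (x :: l') ++ z :: y :: [] := by simp
    rw [this, List.isChain_append_cons_cons] at h3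
    exact h3.2.1

lemma LP.split {G : SimpleGraph V} {x y : V} {M : Set V} (Z : Set V) (h : LP G x M y)
    (hZ : (M ∩ Z).Nonempty) : ∃ z M1 M2, z ∈ M ∧ z ∈ Z ∧ (∀ w, w ∈ M ↔ (w ∈ M1 ∨ w = z ∨ w ∈ M2)) ∧
      z ∉ M1 ∧ z ∉ M2 ∧ (∀ w ∈ M1, w ∉ M2) ∧ (∀ w ∈ M1, w ∉ Z) ∧ LP G x M1 z ∧ LP G z M2 y := by
  obtain ⟨l, h1, h2, h3⟩ := h
  have key : ∀ l : List V, (∃ w ∈ l, w ∈ Z) → ∃ l1 z l2, l = l1 ++ z :: l2 ∧ z ∈ Z ∧ ∀ w ∈ l1, w ∉ Z := by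
    intro l
    induction l with
    | nil => simp
    | cons a l ih =>
      intro hw
      by_cases ha : a ∈ Z
      · exact ⟨[], a, l, rfl, ha, by simp⟩
      · obtain ⟨l1, z, l2, e, h1, h2⟩ := ih (by simpa [ha] using hw)
        exact ⟨a :: l1, z, l2, by simp [e], h1, by simpa [ha] using h2⟩
  obtain ⟨w, hw⟩ := hZ
  obtain ⟨l1, z, l2, rfl, hz, hl1⟩ := key l ⟨w, (h2 w).1 hw.1, hw.2⟩
  have e : x :: (l1 ++ z :: l2 ++ [y]) = (x :: l1) ++ z :: (l2 ++ [y]) := by simp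
  rw [e, List.isChain_split] at h3
  rw [List.nodup_append] at h1
  refine ⟨z, {w | w ∈ l1}, {w | w ∈ l2}, (h2 z).2 (by simp), hz, by intro w; simp [h2], ?_, ?_, ?_, hl1,
    ⟨l1, h1.1, by simp, by simpa using h3.1⟩, ⟨l2, ?_, by simp, h3.2⟩⟩
  all_goals grind

lemma geo {G : SimpleGraph V} (r : ℕ) {C : Set V} {x y : V} (hC : (G.induce C).Connected)
    (hx : x ∈ Nb G C) (hy : y ∈ Nb G C) (hxy : x ≠ y) :
    ∃ S ⊆ C, S.Nonempty ∧ LP G x S y ∧ Flat G r C (S ∪ {x, y}) := by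
  classical
  obtain ⟨hxC, c, hc, hxc⟩ := hx
  obtain ⟨hyC, d, hd, hyd⟩ := hy
  let H : SimpleGraph V :=
    { Adj := fun u v => G.Adj u v ∧ (u ∈ C ∨ u = x ∨ u = y) ∧ (v ∈ C ∨ v = x ∨ v = y) ∧ (u ∈ C ∨ v ∈ C)
      symm := ⟨fun u v h => ⟨h.1.symm, h.2.2.1, h.2.1, h.2.2.2.symm⟩⟩
      loopless := ⟨fun u h => G.loopless.irrefl u h.1⟩ }
  have hHG : ∀ {u v}, H.Adj u v → G.Adj u v := fun h => h.1
  have hCC : ∀ u ∈ C, ∀ v ∈ C, H.Reachable u v := by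
    intro u hu v hv
    let φ : G.induce C →g H :=
      ⟨fun u => u.1, fun {a b} h => ⟨h, Or.inl a.2, Or.inl b.2, Or.inl a.2⟩⟩
    exact (hC.preconnected ⟨u, hu⟩ ⟨v, hv⟩).map φ
  have hxcH : H.Adj x c := ⟨hxc, by simp, by simp [hc], Or.inr hc⟩
  have hydH : H.Adj y d := ⟨hyd, by simp, by simp [hd], Or.inr hd⟩
  have hxR : ∀ u, (u ∈ C ∨ u = x ∨ u = y) → H.Reachable x u := by
    rintro u (hu | rfl | rfl)
    · exact hxcH.reachable.trans (hCC _ hc _ hu)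
    · rfl
    · exact hxcH.reachable.trans ((hCC _ hc _ hd).trans hydH.symm.reachable)
  obtain ⟨p, hp⟩ := (hxR y (by simp)).exists_walk_length_eq_dist
  have hpath := p.isPath_of_length_eq_dist hp
  -- distances along p
  have hdist : ∀ i ≤ p.length, H.dist x (p.getVert i) = i := by
    intro i hi
    have h1 := H.dist_le (p.take i)
    have h2 := H.dist_le (p.drop i)
    rw [SimpleGraph.Walk.take_length] at h1
    rw [SimpleGraph.Walk.drop_length] at h2
    have h3 := (p.take i).reachable.dist_triangle_left y
    omega
  have hinj : ∀ u ∈ p.support, ∀ u' ∈ p.support, H.dist x u = H.dist x u' → u = u' := by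
    intro u hu u' hu' e
    obtain ⟨i, rfl, hi⟩ := SimpleGraph.Walk.mem_support_iff_exists_getVert.1 hu
    obtain ⟨j, rfl, hj⟩ := SimpleGraph.Walk.mem_support_iff_exists_getVert.1 hu'
    rw [hdist i hi, hdist j hj] at e
    rw [e]
  -- the reach
  have hreach : ∀ n v u, (u ∈ C ∨ u = x ∨ u = y) → Rch G C n v u →
      H.Reachable v u ∧ H.dist v u ≤ n := by
    intro n
    induction n with
    | zero => intro v u _ h; cases h; simp
    | succ n ih =>
      rintro v u hu (rfl | ⟨hv, w, hw, h⟩)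
      · simp
      · obtain ⟨h1, h2⟩ := ih w u hu h
        have hwm : w ∈ C ∨ w = x ∨ w = y := by
          cases n with
          | zero => cases h; exact hu
          | succ n =>
            rcases h with rfl | ⟨h, _⟩
            · exact hu
            · exact Or.inl h
        have hvw : H.Adj v w := ⟨hw, Or.inl hv, hwm, Or.inl hv⟩
        refine ⟨hvw.reachable.trans h1, ?_⟩
        have := hvw.reachable.dist_triangle_left u
        have h3 := SimpleGraph.dist_eq_one_iff_adj.2 hvw
        omega
  have hsupp : ∀ u ∈ p.support, u ∈ C ∨ u = x ∨ u = y := by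
    have : ∀ {a b : V} (q : H.Walk a b), (a ∈ C ∨ a = x ∨ a = y) →
        ∀ u ∈ q.support, u ∈ C ∨ u = x ∨ u = y := by
      intro a b q
      induction q with
      | nil => intro h u hu; simp at hu; rw [hu]; exact h
      | cons h q ih =>
        intro ha u hu
        rw [SimpleGraph.Walk.support_cons, List.mem_cons] at hu
        rcases hu with rfl | hu
        · exact ha
        · exact ih h.2.2.1 u hu
    exact this p (by simp)
  have hflat : Flat G r C {u | u ∈ p.support} := by
    intro v hv
    have hmaps : ∀ u ∈ {u | u ∈ {u | u ∈ p.support} ∧ Rch G C r v u},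
        H.dist x u ∈ (↑(Finset.Icc (H.dist x v - r) (H.dist x v + r)) : Set ℕ) := by
      rintro u ⟨hu, hru⟩
      have hum := hsupp u hu
      obtain ⟨h1, h2⟩ := hreach r v u hum hru
      have h3 := (hxR v (Or.inl hv)).dist_triangle_left u
      have h4 := (hxR u hum).dist_triangle_left v
      rw [H.dist_comm (u := u) (v := v)] at h4
      simp only [Finset.coe_Icc, Set.mem_Icc]
      omega
    have := Set.ncard_le_ncard_of_injOn (H.dist x) hmaps
      (fun u hu u' hu' e => hinj u hu.1 u' hu'.1 e) (Finset.finite_toSet _)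
    rw [Set.ncard_coe_finset, Nat.card_Icc] at this
    omega
  have hchain := p.isChain_adj_support
  clear hdist hinj hreach
  cases p with
  | nil => exact absurd rfl hxy
  | @cons _ z _ h q =>
    have hq : q.support.dropLast ++ [y] = q.support := by
      have := List.dropLast_append_getLast q.support_ne_nil
      rwa [q.getLast_support] at this
    have hpn := hpath.support_nodup
    rw [SimpleGraph.Walk.support_cons] at hpn hchain hflat hsupp
    generalize hl : q.support.dropLast = l at hq
    rw [← hq] at hpn hchain hflat hsupp
    refine ⟨{w | w ∈ l}, ?_, ?_, ⟨l, ?_, by simp, hchain.imp fun _ _ h => hHG h⟩,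
      hflat.mono subset_rfl ?_⟩
    · intro w hw
      have := hsupp w (by simp only [Set.mem_ofPred_eq] at hw; simp [hw])
      simp only [Set.mem_ofPred_eq] at hw
      rcases this with h | rfl | rfl
      · exact h
      · exact absurd (by simp [hw]) (List.nodup_cons.1 hpn).1
      · rw [List.nodup_cons, List.nodup_append] at hpn
        exact absurd rfl (hpn.2.2.2 _ hw _ (by simp))
    · cases l with
      | nil =>
        exfalso
        simp only [List.nil_append] at hchain
        rw [List.isChain_cons_cons] at hchain
        rcases hchain.1.2.2.2 with h | h
        · exact hxC h
        · exact hyC h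
      | cons a l => exact ⟨a, by simp⟩
    · rw [List.nodup_cons, List.nodup_append] at hpn
      exact hpn.2.1
    · intro w hw
      simp only [Set.mem_union, Set.mem_insert_iff, Set.mem_singleton_iff, Set.mem_ofPred_eq,
        List.mem_cons, List.mem_append, List.not_mem_nil, or_false] at hw ⊢
      clear hflat hsupp
      rcases hw with h | h | h
      · exact Or.inr (Or.inl h)
      · exact Or.inl h
      · exact Or.inr (Or.inr h)

/-- the state of the construction -/
structure Pre (G : SimpleGraph V) (r n : ℕ) (C Z W : Set V) (U : Fin n → Set V)
    (M : Fin n → Fin n → Set V) (f : Fin n → Fin n → V) (J : Fin n → Fin n → Prop) : Prop where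
  conn : ∀ a, (U a).Nonempty → (G.induce (U a)).Connected
  Jne : ∀ a b, J a b → a ≠ b
  Jsymm : ∀ a b, J a b → J b a
  Jf : ∀ a b, J a b → f a b ∈ U a
  Jlp : ∀ a b, J a b → LP G (f a b) (M a b) (f b a)
  nJ : ∀ a b w, w ∈ M a b → J a b
  Msymm : ∀ a b w, w ∈ M a b → w ∈ M b a
  dU : ∀ a b w, w ∈ U a → w ∈ U b → a = b
  dMU : ∀ a b c w, w ∈ M a b → w ∉ U c
  dMM : ∀ a b c d w, w ∈ M a b → w ∈ M c d → (a = c ∧ b = d) ∨ (a = d ∧ b = c)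
  dUW : ∀ a w, w ∈ U a → w ∉ W
  dMW : ∀ a b w, w ∈ M a b → w ∉ W
  cov : ∀ z ∈ Z, (∃ a, z ∈ U a) ∨ ∃ a b, z ∈ M a b
  covU : ∀ a, ∀ z ∈ Z, z ∈ U a → ∃ b, b ≠ a ∧ z = f a b
  flat : ∀ a b, a ≠ b → Flat G r C (M a b ∪ {f a b, f b a})

lemma Pre.mono {G : SimpleGraph V} {r n : ℕ} {C Z W C' Z' W' : Set V} {U : Fin n → Set V}
    {M : Fin n → Fin n → Set V} {f : Fin n → Fin n → V} {J : Fin n → Fin n → Prop}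
    (h : Pre G r n C Z W U M f J) (hC : C' ⊆ C) (hZ : Z' ⊆ Z) (hW : W' ⊆ W) :
    Pre G r n C' Z' W' U M f J :=
  { h with
    dUW := fun a w hw hw' => h.dUW a w hw (hW hw')
    dMW := fun a b w hw hw' => h.dMW a b w hw (hW hw')
    cov := fun z hz => h.cov z (hZ hz)
    covU := fun a z hz => h.covU a z (hZ hz)
    flat := fun a b hab => (h.flat a b hab).mono hC subset_rfl }

lemma Pre.count {G : SimpleGraph V} {r n : ℕ} {C Z W : Set V} {U : Fin n → Set V}
    {M : Fin n → Fin n → Set V} {f : Fin n → Fin n → V} {J : Fin n → Fin n → Prop}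
    (h : Pre G r n C Z W U M f J) (v : V) (hv : v ∈ C) :
    {u | u ∈ Z ∧ Rch G C r v u}.ncard ≤ n.choose 2 * (2 * r + 1) := by
  classical
  let P : Sym2 (Fin n) → Set V := fun e => {u | (∃ a b, s(a, b) = e ∧ u ∈ M a b ∪ {f a b, f b a}) ∧ Rch G C r v u}
  let E : Finset (Sym2 (Fin n)) := (Finset.univ : Finset (Fin n)).offDiag.image Sym2.mk.uncurry
  have hP : ∀ e ∈ E, (P e).ncard ≤ 2 * r + 1 := by
    intro e he
    simp only [E, Finset.mem_image, Finset.mem_offDiag] at he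
    obtain ⟨⟨a, b⟩, ⟨_, _, hab⟩, rfl⟩ := he
    refine le_trans (Set.ncard_le_ncard ?_ (Set.toFinite _)) (h.flat a b hab v hv)
    rintro u ⟨⟨c, d, hcd, hu⟩, hru⟩
    refine ⟨?_, hru⟩
    have : s(c, d) = s(a, b) := hcd
    rw [Sym2.eq_iff] at this
    rcases this with ⟨rfl, rfl⟩ | ⟨rfl, rfl⟩
    · exact hu
    · rcases hu with hu | hu | hu
      · exact Or.inl (h.Msymm _ _ _ hu)
      · exact Or.inr (Or.inr hu)
      · exact Or.inr (Or.inl hu)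
  have hsub : {u | u ∈ Z ∧ Rch G C r v u} ⊆ ⋃ e ∈ E, P e := by
    rintro u ⟨hu, hru⟩
    have : ∃ a b, a ≠ b ∧ u ∈ M a b ∪ {f a b, f b a} := by
      rcases h.cov u hu with ⟨a, ha⟩ | ⟨a, b, hab⟩
      · obtain ⟨b, hb, e⟩ := h.covU a u hu ha
        exact ⟨a, b, hb.symm, by simp [e]⟩
      · exact ⟨a, b, h.Jne _ _ (h.nJ _ _ _ hab), Or.inl hab⟩
    obtain ⟨a, b, hab, hu'⟩ := this
    simp only [Set.mem_iUnion]
    refine ⟨s(a, b), ?_, ⟨a, b, rfl, hu'⟩, hru⟩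
    simp only [E, Finset.mem_image, Finset.mem_offDiag]
    exact ⟨(a, b), ⟨by simp, by simp, hab⟩, rfl⟩
  have hcard : E.card = n.choose 2 := by
    have := Sym2.card_image_offDiag (Finset.univ : Finset (Fin n))
    simpa [E] using this
  calc _ ≤ (⋃ e ∈ E, P e).ncard := Set.ncard_le_ncard hsub (Set.toFinite _)
    _ ≤ ∑ e ∈ E, (P e).ncard := Finset.set_ncard_biUnion_le E P
    _ ≤ ∑ e ∈ E, (2 * r + 1) := Finset.sum_le_sum hP
    _ = _ := by rw [Finset.sum_const, hcard, smul_eq_mul]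

/-- extension of a dead bag along a live link -/
lemma Pre.extend {G : SimpleGraph V} {r n : ℕ} {C Z W : Set V} {U : Fin n → Set V}
    {M : Fin n → Fin n → Set V} {f : Fin n → Fin n → V} {J : Fin n → Fin n → Prop}
    (h : Pre G r n C Z W U M f J) (a b : Fin n) (hdead : ∀ z ∈ U a, z ∉ Z)
    (hlive : (M a b ∩ Z).Nonempty) :
    ∃ U' M' f', Pre G r n C Z W U' M' f' J ∧ (U' a ∩ Z).Nonempty ∧ ∀ c, c ≠ a → U' c = U c := by
  classical
  have hJ : J a b := h.nJ a b _ hlive.some_mem.1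
  have hab := h.Jne _ _ hJ
  obtain ⟨z, M1, M2, hzM, hzZ, hM, hz1, hz2, h12, h1Z, hL1, hL2⟩ := (h.Jlp a b hJ).split Z hlive
  have hfa := h.Jf a b hJ
  have hU1 : (G.induce (U a ∪ M1)).Connected := hL1.conn hfa (h.conn a ⟨_, hfa⟩)
  have hU2 : (G.induce (U a ∪ M1 ∪ {z})).Connected := by
    obtain ⟨u, hu, huz⟩ := hL1.adj
    have hu' : u ∈ U a ∪ M1 := by
      rcases hu with rfl | hu
      · exact Or.inl hfa
      · exact Or.inr hu
    have := SimpleGraph.induce_union_connected hU1.preconnected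
          (SimpleGraph.induce_pair_connected_of_adj huz).preconnected ⟨u, hu', by simp⟩
    have e : U a ∪ M1 ∪ {z} = U a ∪ M1 ∪ {u, z} := by
      ext w; simp only [Set.mem_union, Set.mem_insert_iff, Set.mem_singleton_iff]; grind
    rw [e]; exact this
  let U' : Fin n → Set V := fun c => if c = a then U a ∪ M1 ∪ {z} else U c
  let M' : Fin n → Fin n → Set V := fun c d =>
    if (c = a ∧ d = b) ∨ (c = b ∧ d = a) then M2 else M c d
  let f' : Fin n → Fin n → V := fun c d => if c = a ∧ d = b then z else f c d
  have hU'a : ∀ w, w ∈ U' a ↔ (w ∈ U a ∨ w ∈ M1 ∨ w = z) := by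
    intro w; simp only [U', if_true, Set.mem_union, Set.mem_singleton_iff, or_assoc]
  have hU'c : ∀ c, c ≠ a → U' c = U c := by intro c hc; simp only [U', if_neg hc]
  have hM'1 : M' a b = M2 := by simp [M']
  have hM'2 : M' b a = M2 := by simp [M']
  have hM'c : ∀ c d, ¬ ((c = a ∧ d = b) ∨ (c = b ∧ d = a)) → M' c d = M c d := by
    intro c d hcd; simp only [M', if_neg hcd]
  have hf'1 : f' a b = z := by simp [f']
  have hf'c : ∀ c d, ¬ (c = a ∧ d = b) → f' c d = f c d := by
    intro c d hcd; simp only [f', if_neg hcd]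
  have hM'sub : ∀ c d w, w ∈ M' c d → w ∈ M c d := by
    intro c d w hw
    by_cases hcd : (c = a ∧ d = b) ∨ (c = b ∧ d = a)
    · rcases hcd with ⟨rfl, rfl⟩ | ⟨rfl, rfl⟩
      · rw [hM'1] at hw; exact (hM w).2 (Or.inr (Or.inr hw))
      · rw [hM'2] at hw; exact h.Msymm _ _ _ ((hM w).2 (Or.inr (Or.inr hw)))
    · rwa [hM'c c d hcd] at hw
  have hUsub : ∀ c w, w ∈ U' c → w ∈ U c ∨ (c = a ∧ w ∈ M a b ∧ w ∉ M2) := by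
    intro c w hw
    by_cases hc : c = a
    · subst hc
      rcases (hU'a w).1 hw with h' | h' | rfl
      · exact Or.inl h'
      · exact Or.inr ⟨rfl, (hM w).2 (Or.inl h'), h12 w h'⟩
      · exact Or.inr ⟨rfl, hzM, hz2⟩
    · rw [hU'c c hc] at hw; exact Or.inl hw
  clear_value U' M' f'
  refine ⟨U', M', f', ?_, ⟨z, (hU'a z).2 (by simp), hzZ⟩, hU'c⟩
  refine { conn := ?_, Jne := h.Jne, Jsymm := h.Jsymm, Jf := ?_, Jlp := ?_, nJ := ?_, Msymm := ?_,
           dU := ?_, dMU := ?_, dMM := ?_, dUW := ?_, dMW := ?_, cov := ?_, covU := ?_, flat := ?_ }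
  · intro c hc
    by_cases hca : c = a
    · subst hca
      have : U' c = U c ∪ M1 ∪ {z} := by
        ext w; rw [hU'a]; simp only [Set.mem_union, Set.mem_singleton_iff, or_assoc]
      rw [this]; exact hU2
    · rw [hU'c c hca] at hc ⊢; exact h.conn c hc
  · intro c d hcd
    by_cases h1 : c = a ∧ d = b
    · obtain ⟨rfl, rfl⟩ := h1
      rw [hf'1]; exact (hU'a z).2 (by simp)
    · rw [hf'c c d h1]
      by_cases hca : c = a
      · subst hca; exact (hU'a _).2 (Or.inl (h.Jf _ _ hcd))
      · rw [hU'c c hca]; exact h.Jf _ _ hcd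
  · intro c d hcd
    by_cases h1 : c = a ∧ d = b
    · obtain ⟨rfl, rfl⟩ := h1
      rw [hf'1, hM'1, hf'c d c (fun h => hab h.2)]; exact hL2
    · by_cases h2 : c = b ∧ d = a
      · obtain ⟨rfl, rfl⟩ := h2
        rw [hf'1, hM'2, hf'c c d (fun h => hab h.2)]; exact hL2.symm
      · rw [hM'c c d (by tauto), hf'c c d h1, hf'c d c (by tauto)]
        exact h.Jlp _ _ hcd
  · intro c d w hw; exact h.nJ _ _ _ (hM'sub _ _ _ hw)
  · intro c d w hw
    by_cases hcd : (c = a ∧ d = b) ∨ (c = b ∧ d = a)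
    · rcases hcd with ⟨rfl, rfl⟩ | ⟨rfl, rfl⟩
      · rw [hM'1] at hw; rw [hM'2]; exact hw
      · rw [hM'2] at hw; rw [hM'1]; exact hw
    · rw [hM'c c d hcd] at hw; rw [hM'c d c (by tauto)]; exact h.Msymm _ _ _ hw
  · intro c d w hc hd
    rcases hUsub c w hc with hc | ⟨rfl, hc, _⟩ <;> rcases hUsub d w hd with hd | ⟨rfl, hd, _⟩
    · exact h.dU _ _ _ hc hd
    · exact absurd hc (h.dMU _ _ _ _ hd)
    · exact absurd hd (h.dMU _ _ _ _ hc)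
    · rfl
  · intro c d e w hw he
    have hw' := hM'sub _ _ _ hw
    rcases hUsub e w he with he | ⟨rfl, he, he2⟩
    · exact h.dMU _ _ _ _ hw' he
    · rcases h.dMM _ _ _ _ _ hw' he with ⟨rfl, rfl⟩ | ⟨rfl, rfl⟩
      · rw [hM'1] at hw; exact he2 hw
      · rw [hM'2] at hw; exact he2 hw
  · intro c d e g w hw hw'
    exact h.dMM _ _ _ _ _ (hM'sub _ _ _ hw) (hM'sub _ _ _ hw')
  · intro c w hw
    rcases hUsub c w hw with hc | ⟨rfl, hc, _⟩
    · exact h.dUW _ _ hc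
    · exact h.dMW _ _ _ hc
  · intro c d w hw; exact h.dMW _ _ _ (hM'sub _ _ _ hw)
  · intro w hw
    rcases h.cov w hw with ⟨c, hc⟩ | ⟨c, d, hcd⟩
    · left
      refine ⟨c, ?_⟩
      by_cases hca : c = a
      · subst hca; exact (hU'a w).2 (Or.inl hc)
      · rw [hU'c c hca]; exact hc
    · by_cases h1 : (c = a ∧ d = b) ∨ (c = b ∧ d = a)
      · have : w ∈ M a b := by
          rcases h1 with ⟨rfl, rfl⟩ | ⟨rfl, rfl⟩
          · exact hcd
          · exact h.Msymm _ _ _ hcd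
        rcases (hM w).1 this with h' | h' | h'
        · exact Or.inl ⟨a, (hU'a w).2 (by simp [h'])⟩
        · exact Or.inl ⟨a, (hU'a w).2 (by simp [h'])⟩
        · exact Or.inr ⟨a, b, by rw [hM'1]; exact h'⟩
      · exact Or.inr ⟨c, d, by rw [hM'c c d h1]; exact hcd⟩
  · intro c w hwZ hw
    by_cases hca : c = a
    · subst hca
      rcases (hU'a w).1 hw with h' | h' | rfl
      · exact absurd hwZ (hdead w h')
      · exact absurd hwZ (h1Z w h')
      · exact ⟨b, hab.symm, hf'1.symm⟩
    · rw [hU'c c hca] at hw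
      obtain ⟨d, hd, e⟩ := h.covU c w hwZ hw
      exact ⟨d, hd, by rw [hf'c c d (fun h => hca h.1)]; exact e⟩
  · intro c d hcd
    refine (h.flat c d hcd).mono subset_rfl ?_
    have key : ∀ c d, f' c d ∈ M c d ∪ {f c d, f d c} := by
      intro c d
      by_cases h1 : c = a ∧ d = b
      · obtain ⟨rfl, rfl⟩ := h1
        rw [hf'1]; exact Or.inl hzM
      · rw [hf'c c d h1]; simp
    rintro w (hw | rfl | rfl)
    · exact Or.inl (hM'sub _ _ _ hw)
    · exact key c d
    · rcases key d c with h' | h' | h'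
      · exact Or.inl (h.Msymm _ _ _ h')
      · exact Or.inr (Or.inr h')
      · exact Or.inr (Or.inl h')

/-- dropping a dead bag -/
lemma Pre.drop {G : SimpleGraph V} {r n : ℕ} {C Z W : Set V} {U : Fin n → Set V}
    {M : Fin n → Fin n → Set V} {f : Fin n → Fin n → V} {J : Fin n → Fin n → Prop}
    (h : Pre G r n C Z W U M f J) (a : Fin n) (hdead : ∀ z ∈ U a, z ∉ Z)
    (hMdead : ∀ b, ∀ z ∈ M a b, z ∉ Z) :
    Pre G r n C Z W (fun c => {w | w ∈ U c ∧ c ≠ a}) (fun c d => {w | w ∈ M c d ∧ c ≠ a ∧ d ≠ a}) f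
      (fun c d => J c d ∧ c ≠ a ∧ d ≠ a) := by
  have eU : ∀ c, c ≠ a → {w | w ∈ U c ∧ c ≠ a} = U c := by intro c hc; ext; simp [hc]
  have eM : ∀ c d, c ≠ a → d ≠ a → {w | w ∈ M c d ∧ c ≠ a ∧ d ≠ a} = M c d := by
    intro c d hc hd; ext; simp [hc, hd]
  refine { conn := ?_, Jne := ?_, Jsymm := ?_, Jf := ?_, Jlp := ?_, nJ := ?_, Msymm := ?_,
           dU := ?_, dMU := ?_, dMM := ?_, dUW := ?_, dMW := ?_, cov := ?_, covU := ?_, flat := ?_ }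
  · rintro c ⟨w, hw, hc⟩
    show (G.induce {w | w ∈ U c ∧ c ≠ a}).Connected
    rw [eU c hc]
    exact h.conn c ⟨w, hw⟩
  · exact fun c d hcd => h.Jne _ _ hcd.1
  · exact fun c d hcd => ⟨h.Jsymm _ _ hcd.1, hcd.2.2, hcd.2.1⟩
  · exact fun c d hcd => ⟨h.Jf _ _ hcd.1, hcd.2.1⟩
  · intro c d hcd
    simp only [eM c d hcd.2.1 hcd.2.2]
    exact h.Jlp _ _ hcd.1
  · exact fun c d w hw => ⟨h.nJ _ _ _ hw.1, hw.2⟩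
  · exact fun c d w hw => ⟨h.Msymm _ _ _ hw.1, hw.2.2, hw.2.1⟩
  · exact fun c d w hw hw' => h.dU _ _ _ hw.1 hw'.1
  · exact fun c d e w hw hw' => h.dMU _ _ _ _ hw.1 hw'.1
  · exact fun c d e g w hw hw' => h.dMM _ _ _ _ _ hw.1 hw'.1
  · exact fun c w hw => h.dUW _ _ hw.1
  · exact fun c d w hw => h.dMW _ _ _ hw.1
  · intro z hz
    rcases h.cov z hz with ⟨c, hc⟩ | ⟨c, d, hcd⟩
    · refine Or.inl ⟨c, hc, ?_⟩
      rintro rfl; exact hdead z hc hz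
    · refine Or.inr ⟨c, d, hcd, ?_, ?_⟩
      · rintro rfl; exact hMdead _ z hcd hz
      · rintro rfl; exact hMdead _ z (h.Msymm _ _ _ hcd) hz
  · exact fun c z hz hw => h.covU c z hz hw.1
  · intro c d hcd
    refine (h.flat c d hcd).mono subset_rfl ?_
    rintro w (hw | hw)
    · exact Or.inl hw.1
    · exact Or.inr hw

lemma Pre.normalize {G : SimpleGraph V} {r n : ℕ} {C Z W : Set V} (k : ℕ) :
    ∀ {U : Fin n → Set V}
    {M : Fin n → Fin n → Set V} {f : Fin n → Fin n → V} {J : Fin n → Fin n → Prop},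
    Pre G r n C Z W U M f J → {a | (U a).Nonempty ∧ ¬ (U a ∩ Z).Nonempty}.ncard = k →
    ∃ U M f J, Pre G r n C Z W U M f J ∧ ∀ a, (U a).Nonempty → (U a ∩ Z).Nonempty := by
  induction k using Nat.strong_induction_on with
  | _ k ih =>
  intro U M f J h hk
  by_cases hall : ∀ a, (U a).Nonempty → (U a ∩ Z).Nonempty
  · exact ⟨U, M, f, J, h, hall⟩
  push Not at hall
  obtain ⟨a, ha, haZ⟩ := hall
  have hdead : ∀ z ∈ U a, z ∉ Z := fun z hz hz' => by
    have : z ∈ U a ∩ Z := ⟨hz, hz'⟩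
    rw [haZ] at this; exact this
  have main : ∀ U' : Fin n → Set V, ((U' a).Nonempty → (U' a ∩ Z).Nonempty) →
      (∀ c, c ≠ a → U' c = U c) → {a | (U' a).Nonempty ∧ ¬ (U' a ∩ Z).Nonempty}.ncard < k := by
    intro U' h1 h2
    rw [← hk]
    refine Set.ncard_lt_ncard ?_ (Set.toFinite _)
    rw [Set.ssubset_iff_of_subset]
    · exact ⟨a, ⟨ha, by rw [haZ]; simp⟩, fun h => h.2 (h1 h.1)⟩
    · rintro c ⟨hc1, hc2⟩
      have : c ≠ a := by rintro rfl; exact hc2 (h1 hc1)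
      rw [h2 c this] at hc1 hc2
      exact ⟨hc1, hc2⟩
  by_cases hb : ∃ b, (M a b ∩ Z).Nonempty
  · obtain ⟨b, hb⟩ := hb
    obtain ⟨U', M', f', h', hl, hc⟩ := h.extend a b hdead hb
    exact ih _ (main U' (fun _ => hl) hc) h' rfl
  · have h' := h.drop a hdead (fun b z hz hz' => hb ⟨b, z, hz, hz'⟩)
    refine ih _ (main _ ?_ ?_) h' rfl
    · rintro ⟨w, hw⟩; exact absurd rfl hw.2
    · intro c hc; ext; simp [hc]

lemma Pre.newVertex {G : SimpleGraph V} {r n : ℕ} (hr : 1 ≤ r) (hn : 2 ≤ n) {C : Set V}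
    {U : Fin n → Set V}
    {M : Fin n → Fin n → Set V} {f : Fin n → Fin n → V} {J : Fin n → Fin n → Prop}
    (h : Pre G r n C (Nb G C) C U M f J) (a : Fin n) (ha : ¬ (U a).Nonempty) (x : V) (hx : x ∈ C) :
    Pre G r n C (Nb G C ∪ {x}) (C \ {x}) (fun c => {w | w ∈ U c ∨ (c = a ∧ w = x)}) M
      (fun c d => if c = a then x else f c d) J := by
  have ha' : ∀ w, w ∉ U a := fun w hw => ha ⟨w, hw⟩
  have hJa : ∀ c d, J c d → c ≠ a := by
    rintro c d hcd rfl; exact ha' _ (h.Jf _ _ hcd)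
  have hJb : ∀ c d, J c d → d ≠ a := fun c d hcd => hJa d c (h.Jsymm _ _ hcd)
  have eU : ∀ c, c ≠ a → {w | w ∈ U c ∨ (c = a ∧ w = x)} = U c := by intro c hc; ext; simp [hc]
  refine { conn := ?_, Jne := h.Jne, Jsymm := h.Jsymm, Jf := ?_, Jlp := ?_, nJ := h.nJ,
           Msymm := h.Msymm,
           dU := ?_, dMU := ?_, dMM := h.dMM, dUW := ?_, dMW := ?_, cov := ?_, covU := ?_, flat := ?_ }
  · intro c hc
    show (G.induce {w | w ∈ U c ∨ (c = a ∧ w = x)}).Connected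
    by_cases hca : c = a
    · have : {w | w ∈ U c ∨ (c = a ∧ w = x)} = {x} := by
        ext w; subst hca; simp [ha']
      rw [this]
      have : Nonempty ({x} : Set V) := ⟨⟨x, rfl⟩⟩
      have : Subsingleton ({x} : Set V) := by
        constructor; rintro ⟨a, rfl⟩ ⟨b, rfl⟩; rfl
      exact ⟨SimpleGraph.Preconnected.of_subsingleton⟩
    · rw [eU c hca]
      refine h.conn c ?_
      obtain ⟨w, hw⟩ := hc
      exact ⟨w, by simpa [hca] using hw⟩
  · intro c d hcd
    simp only [if_neg (hJa _ _ hcd)]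
    exact Or.inl (h.Jf _ _ hcd)
  · intro c d hcd
    simp only [if_neg (hJa _ _ hcd), if_neg (hJb _ _ hcd)]
    exact h.Jlp _ _ hcd
  · rintro c d w (hc | ⟨rfl, rfl⟩) (hd | ⟨rfl, hw⟩)
    · exact h.dU _ _ _ hc hd
    · subst hw; exact absurd hx (h.dUW _ _ hc)
    · exact absurd hx (h.dUW _ _ hd)
    · rfl
  · rintro c d e w hw (he | ⟨_, rfl⟩)
    · exact h.dMU _ _ _ _ hw he
    · exact h.dMW _ _ _ hw hx
  · rintro c w (hw | ⟨_, rfl⟩) hw'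
    · exact h.dUW _ _ hw hw'.1
    · exact hw'.2 rfl
  · exact fun c d w hw hw' => h.dMW _ _ _ hw hw'.1
  · rintro z (hz | rfl)
    · rcases h.cov z hz with ⟨c, hc⟩ | hc
      · exact Or.inl ⟨c, Or.inl hc⟩
      · exact Or.inr hc
    · exact Or.inl ⟨a, Or.inr ⟨rfl, rfl⟩⟩
  · rintro c z hz hw
    by_cases hca : c = a
    · subst hca
      have : Nontrivial (Fin n) := Fin.nontrivial_iff_two_le.2 hn
      obtain ⟨b, hb⟩ := exists_ne c
      refine ⟨b, hb, ?_⟩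
      rcases hw with hw | hw
      · exact absurd hw (ha' _)
      · simp [hw.2]
    · rcases hw with hw | hw
      · rcases hz with hz | rfl
        · obtain ⟨b, hb, e⟩ := h.covU c z hz hw
          exact ⟨b, hb, by simp [hca, e]⟩
        · exact absurd hx (h.dUW _ _ hw)
      · exact absurd hw.1 hca
  · intro c d hcd
    by_cases hJ : J c d
    · simp only [if_neg (hJa _ _ hJ), if_neg (hJb _ _ hJ)]
      exact h.flat c d hcd
    · have : M c d = ∅ := by
        ext w; simp only [Set.mem_empty_iff_false, iff_false]
        exact fun hw => hJ (h.nJ _ _ _ hw)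
      rw [this]
      exact flat_pair hr _ _ _

lemma Pre.setF {G : SimpleGraph V} {r n : ℕ} (hr : 1 ≤ r) {C Z W : Set V}
    {U : Fin n → Set V}
    {M : Fin n → Fin n → Set V} {f : Fin n → Fin n → V} {J : Fin n → Fin n → Prop}
    (h : Pre G r n C Z W U M f J) (a b : Fin n) (hab : a ≠ b) (hJ : ¬ J a b)
    (hl : (U a ∩ Z).Nonempty) :
    ∃ f', Pre G r n C Z W U M f' J ∧ f' a b ∈ U a ∧ f' a b ∈ Z ∧ f' b a = f b a := by
  classical
  by_cases hf : f a b ∈ U a ∩ Z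
  · exact ⟨f, h, hf.1, hf.2, rfl⟩
  obtain ⟨x, hxU, hxZ⟩ := hl
  have hJ' : ¬ J b a := fun hh => hJ (h.Jsymm _ _ hh)
  let f' : Fin n → Fin n → V := fun c d => if c = a ∧ d = b then x else f c d
  have h1 : f' a b = x := by simp [f']
  have h2 : ∀ c d, ¬ (c = a ∧ d = b) → f' c d = f c d := by
    intro c d hcd; simp only [f', if_neg hcd]
  clear_value f'
  refine ⟨f', ?_, by rw [h1]; exact hxU, by rw [h1]; exact hxZ, h2 _ _ (fun hh => hab hh.2)⟩
  have k1 : ∀ c d, J c d → ¬ (c = a ∧ d = b) := by rintro c d hcd ⟨rfl, rfl⟩; exact hJ hcd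
  refine { h with Jf := ?_, Jlp := ?_, covU := ?_, flat := ?_ }
  · intro c d hcd
    rw [h2 c d (k1 c d hcd)]; exact h.Jf _ _ hcd
  · intro c d hcd
    rw [h2 c d (k1 c d hcd), h2 d c (k1 d c (h.Jsymm _ _ hcd))]; exact h.Jlp _ _ hcd
  · intro c z hz hc
    obtain ⟨d, hd, e⟩ := h.covU c z hz hc
    refine ⟨d, hd, ?_⟩
    rw [h2 c d ?_]
    · exact e
    · rintro ⟨rfl, rfl⟩
      rw [e] at hz hc
      exact hf ⟨hc, hz⟩
  · intro c d hcd
    by_cases hJcd : J c d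
    · rw [h2 c d (k1 c d hJcd), h2 d c (k1 d c (h.Jsymm _ _ hJcd))]
      exact h.flat c d hcd
    · have : M c d = ∅ := by
        ext w; simp only [Set.mem_empty_iff_false, iff_false]
        exact fun hw => hJcd (h.nJ _ _ _ hw)
      rw [this]
      exact flat_pair hr _ _ _

lemma Pre.newPath {G : SimpleGraph V} {r n : ℕ} {C S : Set V}
    {U : Fin n → Set V}
    {M : Fin n → Fin n → Set V} {f : Fin n → Fin n → V} {J : Fin n → Fin n → Prop}
    (h : Pre G r n C (Nb G C) C U M f J) (a b : Fin n) (hab : a ≠ b) (hJ : ¬ J a b)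
    (ha : f a b ∈ U a) (hb : f b a ∈ U b) (hS : S ⊆ C) (hlp : LP G (f a b) S (f b a))
    (hfl : Flat G r C (S ∪ {f a b, f b a})) :
    ∃ M' J', Pre G r n C (Nb G C ∪ S) (C \ S) U M' f J' := by
  classical
  let Q : Fin n → Fin n → Prop := fun c d => (c = a ∧ d = b) ∨ (c = b ∧ d = a)
  have hQs : ∀ c d, Q c d → Q d c := by intro c d; simp only [Q]; tauto
  have hQJ : ∀ c d, Q c d → ¬ J c d := by
    rintro c d (⟨rfl, rfl⟩ | ⟨rfl, rfl⟩)
    · exact hJ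
    · exact fun hh => hJ (h.Jsymm _ _ hh)
  have hQM : ∀ c d, Q c d → ∀ w, w ∉ M c d := fun c d hq w hw => hQJ c d hq (h.nJ _ _ _ hw)
  let M' : Fin n → Fin n → Set V := fun c d => {w | w ∈ M c d ∨ (Q c d ∧ w ∈ S)}
  have eM : ∀ c d, ¬ Q c d → M' c d = M c d := by intro c d hq; ext; simp [M', hq]
  have eM' : ∀ c d, Q c d → M' c d = S := by
    intro c d hq; ext w; simp [M', hq, hQM c d hq w]
  refine ⟨M', fun c d => J c d ∨ Q c d, ?_⟩
  refine { conn := h.conn, Jne := ?_, Jsymm := ?_, Jf := ?_, Jlp := ?_, nJ := ?_, Msymm := ?_,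
           dU := h.dU, dMU := ?_, dMM := ?_, dUW := ?_, dMW := ?_, cov := ?_, covU := ?_, flat := ?_ }
  · rintro c d (hcd | ⟨rfl, rfl⟩ | ⟨rfl, rfl⟩)
    · exact h.Jne _ _ hcd
    · exact hab
    · exact hab.symm
  · rintro c d (hcd | hq)
    · exact Or.inl (h.Jsymm _ _ hcd)
    · exact Or.inr (hQs _ _ hq)
  · rintro c d (hcd | ⟨rfl, rfl⟩ | ⟨rfl, rfl⟩)
    · exact h.Jf _ _ hcd
    · exact ha
    · exact hb
  · rintro c d (hcd | hq)
    · rw [eM c d (fun hq => hQJ _ _ hq hcd)]; exact h.Jlp _ _ hcd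
    · rw [eM' c d hq]
      rcases hq with ⟨rfl, rfl⟩ | ⟨rfl, rfl⟩
      · exact hlp
      · exact hlp.symm
  · rintro c d w (hw | hw)
    · exact Or.inl (h.nJ _ _ _ hw)
    · exact Or.inr hw.1
  · rintro c d w (hw | hw)
    · exact Or.inl (h.Msymm _ _ _ hw)
    · exact Or.inr ⟨hQs _ _ hw.1, hw.2⟩
  · rintro c d e w (hw | hw) he
    · exact h.dMU _ _ _ _ hw he
    · exact h.dUW _ _ he (hS hw.2)
  · rintro c d e g w (hw | hw) (hw' | hw')
    · exact h.dMM _ _ _ _ _ hw hw'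
    · exact absurd (hS hw'.2) (h.dMW _ _ _ hw)
    · exact absurd (hS hw.2) (h.dMW _ _ _ hw')
    · rcases hw.1 with ⟨rfl, rfl⟩ | ⟨rfl, rfl⟩ <;> rcases hw'.1 with ⟨rfl, rfl⟩ | ⟨rfl, rfl⟩ <;> simp
  · exact fun c w hw hw' => h.dUW _ _ hw hw'.1
  · rintro c d w (hw | hw) hw'
    · exact h.dMW _ _ _ hw hw'.1
    · exact hw'.2 hw.2
  · rintro z (hz | hz)
    · rcases h.cov z hz with hc | ⟨c, d, hcd⟩
      · exact Or.inl hc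
      · exact Or.inr ⟨c, d, Or.inl hcd⟩
    · exact Or.inr ⟨a, b, Or.inr ⟨Or.inl ⟨rfl, rfl⟩, hz⟩⟩
  · rintro c z (hz | hz) hw
    · exact h.covU c z hz hw
    · exact absurd (hS hz) (h.dUW _ _ hw)
  · intro c d hcd
    by_cases hq : Q c d
    · rw [eM' c d hq]
      rcases hq with ⟨rfl, rfl⟩ | ⟨rfl, rfl⟩
      · exact hfl
      · rw [Set.pair_comm]; exact hfl
    · rw [eM c d hq]; exact h.flat c d hcd

lemma Pre.minor {G : SimpleGraph V} {r n : ℕ} {C : Set V} (hC : (G.induce C).Connected)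
    (hCne : C.Nonempty)
    {U : Fin n → Set V}
    {M : Fin n → Fin n → Set V} {f : Fin n → Fin n → V} {J : Fin n → Fin n → Prop}
    (h : Pre G r n C (Nb G C) C U M f J) (hl : ∀ a, (U a ∩ Nb G C).Nonempty)
    (hJ : ∀ a b, a ≠ b → J a b) : HasKtMinor G (n + 1) := by
  let B' : Fin n → Set V := fun a => {w | w ∈ U a ∨ ∃ b, a < b ∧ w ∈ M a b}
  have hUB : ∀ a, U a ⊆ B' a := fun a w hw => Or.inl hw
  have hUne : ∀ a, (U a).Nonempty := fun a => (hl a).mono Set.inter_subset_left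
  have hconn : ∀ a, (G.induce (B' a)).Connected := by
    intro a
    obtain ⟨u, hu⟩ := hUne a
    refine G.induce_connected_of_patches u (hUB a hu) ?_
    rintro v (hv | ⟨b, hab, hv⟩)
    · exact ⟨U a, hUB a, hu, hv, (h.conn a ⟨u, hu⟩).preconnected _ _⟩
    · have hj := hJ a b hab.ne
      refine ⟨U a ∪ M a b, ?_, Or.inl hu, Or.inr hv,
        ((h.Jlp a b hj).conn (h.Jf a b hj) (h.conn a ⟨u, hu⟩)).preconnected _ _⟩
      rintro w (hw | hw)
      · exact Or.inl hw
      · exact Or.inr ⟨b, hab, hw⟩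
  have hdisj : ∀ a b w, w ∈ B' a → w ∈ B' b → a = b := by
    rintro a b w (ha | ⟨c, hac, ha⟩) (hb | ⟨d, hbd, hb⟩)
    · exact h.dU _ _ _ ha hb
    · exact absurd ha (h.dMU _ _ _ _ hb)
    · exact absurd hb (h.dMU _ _ _ _ ha)
    · rcases h.dMM _ _ _ _ _ ha hb with ⟨rfl, rfl⟩ | ⟨rfl, rfl⟩
      · rfl
      · exact absurd hac hbd.asymm
  have hdC : ∀ a w, w ∈ B' a → w ∉ C := by
    rintro a w (ha | ⟨c, hac, ha⟩)
    · exact h.dUW _ _ ha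
    · exact h.dMW _ _ _ ha
  have hadj : ∀ a b, a < b → ∃ u ∈ B' a, ∃ v ∈ B' b, G.Adj u v := by
    intro a b hab
    have hj := hJ a b hab.ne
    obtain ⟨u, hu, huv⟩ := (h.Jlp a b hj).adj
    refine ⟨u, ?_, f b a, hUB b (h.Jf b a (h.Jsymm _ _ hj)), huv⟩
    rcases hu with rfl | hu
    · exact hUB a (h.Jf a b hj)
    · exact Or.inr ⟨b, hab, hu⟩
  have hadjC : ∀ a, ∃ u ∈ B' a, ∃ v ∈ C, G.Adj u v := by
    intro a
    obtain ⟨u, hu, _, c, hc, huc⟩ := hl a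
    exact ⟨u, hUB a hu, c, hc, huc⟩
  refine ⟨Fin.cases C B', ?_, ?_, ?_, ?_⟩
  · intro i
    refine Fin.cases ?_ (fun a => ?_) i
    · exact hCne
    · exact (hUne a).mono (hUB a)
  · intro i
    refine Fin.cases ?_ (fun a => ?_) i
    · exact hC
    · exact hconn a
  · intro i j
    refine Fin.cases ?_ (fun a => ?_) i <;> refine Fin.cases ?_ (fun b => ?_) j
    · intro hh; exact absurd rfl hh
    · intro _; exact Set.disjoint_left.2 fun w hw hw' => hdC b w hw' hw
    · intro _; exact Set.disjoint_left.2 fun w hw hw' => hdC a w hw hw'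
    · intro hh; exact Set.disjoint_left.2 fun w hw hw' => hh (by rw [hdisj a b w hw hw'])
  · intro i j
    refine Fin.cases ?_ (fun a => ?_) i <;> refine Fin.cases ?_ (fun b => ?_) j
    · intro hh; exact absurd rfl hh
    · intro _
      obtain ⟨u, hu, v, hv, huv⟩ := hadjC b
      exact ⟨v, hv, u, hu, huv.symm⟩
    · intro _; exact hadjC a
    · intro hh
      have hab : a ≠ b := fun e => hh (by rw [e])
      rcases lt_or_gt_of_ne hab with hlt | hlt
      · exact hadj a b hlt
      · obtain ⟨u, hu, v, hv, huv⟩ := hadj b a hlt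
        exact ⟨v, hv, u, hu, huv.symm⟩

def Good (G : SimpleGraph V) (r n : ℕ) (C : Set V) : Prop :=
  ∃ U M f J, Pre G r n C (Nb G C) C U M f J

lemma Good.step {G : SimpleGraph V} {r n : ℕ} (hr : 1 ≤ r) (hn : 2 ≤ n)
    (hG : ¬ HasKtMinor G (n + 1)) {C : Set V} (hC : (G.induce C).Connected) (hCne : C.Nonempty)
    (h : Good G r n C) : ∃ S ⊆ C, S.Nonempty ∧ ∃ U M f J,
      Pre G r n C (Nb G C ∪ S) (C \ S) U M f J := by
  obtain ⟨U₀, M₀, f₀, J₀, h₀⟩ := h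
  obtain ⟨U, M, f, J, h, hl⟩ := h₀.normalize _ rfl
  by_cases hA : ∃ a, ¬ (U a).Nonempty
  · obtain ⟨a, ha⟩ := hA
    obtain ⟨x, hx⟩ := hCne
    exact ⟨{x}, by simpa using hx, ⟨x, rfl⟩, _, _, _, _, h.newVertex hr hn a ha x hx⟩
  push Not at hA
  by_cases hB : ∃ a b, a ≠ b ∧ ¬ J a b
  · obtain ⟨a, b, hab, hJ⟩ := hB
    have hJ' : ¬ J b a := fun hh => hJ (h.Jsymm _ _ hh)
    obtain ⟨f1, h1, ha1, haZ1, _⟩ := h.setF hr a b hab hJ (hl a (hA a))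
    obtain ⟨f2, h2, hb2, hbZ2, e⟩ := h1.setF hr b a hab.symm hJ' (hl b (hA b))
    rw [← e] at ha1 haZ1
    have hne : f2 a b ≠ f2 b a := by
      intro e; rw [e] at ha1; exact hab (h2.dU _ _ _ ha1 hb2)
    obtain ⟨S, hS, hSne, hlp, hfl⟩ := geo r hC haZ1 hbZ2 hne
    obtain ⟨M', J', h3⟩ := h2.newPath a b hab hJ ha1 hb2 hS hlp hfl
    exact ⟨S, hS, hSne, _, _, _, _, h3⟩
  · push Not at hB
    exact absurd (h.minor hC hCne (fun a => hl a (hA a)) hB) hG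

structure IsComp (G : SimpleGraph V) (D X : Set V) : Prop where
  sub : X ⊆ D
  conn : (G.induce X).Connected
  closed : ∀ x ∈ X, ∀ y ∈ D, G.Adj x y → y ∈ X

lemma IsComp.nonempty {G : SimpleGraph V} {D X : Set V} (h : IsComp G D X) : X.Nonempty := by
  obtain ⟨x⟩ := h.conn.nonempty
  exact ⟨x.1, x.2⟩

lemma exists_comp (G : SimpleGraph V) {D : Set V} (hD : D.Nonempty) : ∃ X, IsComp G D X := by
  obtain ⟨v, hv⟩ := hD
  let F : Set (Set V) := {X | X ⊆ D ∧ (G.induce X).Connected}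
  have hF : F.Nonempty := by
    refine ⟨{v}, by simpa using hv, ?_⟩
    have : Nonempty ({v} : Set V) := ⟨⟨v, rfl⟩⟩
    have : Subsingleton ({v} : Set V) := by
      constructor; rintro ⟨a, rfl⟩ ⟨b, rfl⟩; rfl
    exact ⟨SimpleGraph.Preconnected.of_subsingleton⟩
  obtain ⟨X, hX⟩ := (Set.toFinite F).exists_maximal hF
  refine ⟨X, hX.prop.1, hX.prop.2, ?_⟩
  intro x hx y hy hxy
  have : X ∪ {x, y} ∈ F := by
    refine ⟨?_, SimpleGraph.induce_union_connected hX.prop.2.preconnected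
          (SimpleGraph.induce_pair_connected_of_adj hxy).preconnected ⟨x, hx, by simp⟩⟩
    rintro w (hw | rfl | rfl)
    · exact hX.prop.1 hw
    · exact hX.prop.1 hx
    · exact hy
  exact hX.le_of_ge this Set.subset_union_left (by simp)

lemma conn_sub {G : SimpleGraph V} {X Y : Set V} (hY : (G.induce Y).Connected)
    (hX : ∀ x ∈ X, ∀ y ∈ Y, G.Adj x y → y ∈ X) (hXY : (Y ∩ X).Nonempty) : Y ⊆ X := by
  obtain ⟨v, hvY, hvX⟩ := hXY
  intro w hw
  obtain ⟨p⟩ := hY.preconnected ⟨v, hvY⟩ ⟨w, hw⟩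
  have : ∀ (a b : Y) (p : (G.induce Y).Walk a b), a.1 ∈ X → b.1 ∈ X := by
    intro a b p
    induction p with
    | nil => exact id
    | cons h q ih => exact fun ha => ih (hX _ ha _ (Subtype.property _) h)
  exact this _ _ p hvX

def RSet (G : SimpleGraph V) (r : ℕ) (D : Set V) (ρ : V → ℕ) (v : V) : Set V :=
  {u | (u ∈ D → ρ u ≤ ρ v) ∧ Rch G (insert v {w | w ∈ D ∧ ρ v < ρ w}) r v u}

lemma order_exists {G : SimpleGraph V} {r n : ℕ} (hr : 1 ≤ r) (hn : 2 ≤ n)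
    (hG : ¬ HasKtMinor G (n + 1)) (m : ℕ) : ∀ D : Set V, D.ncard = m →
    (∀ X, IsComp G D X → Good G r n X) →
    ∃ ρ : V → ℕ, Set.InjOn ρ D ∧
      ∀ v ∈ D, (RSet G r D ρ v).ncard ≤ n.choose 2 * (2 * r + 1) := by
  classical
  induction m using Nat.strong_induction_on with
  | _ m ih =>
  intro D hDm hgood
  rcases D.eq_empty_or_nonempty with rfl | hD
  · exact ⟨fun _ => 0, by simp, by simp⟩
  obtain ⟨X, hX⟩ := exists_comp G hD
  obtain ⟨S, hSX, hSne, U, M, f, J, hpre⟩ := (hgood X hX).step hr hn hG hX.conn hX.nonempty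
  have hSD : S ⊆ D := hSX.trans hX.sub
  have hlt : (D \ S).ncard < m := by
    rw [← hDm]
    refine Set.ncard_lt_ncard ?_ (Set.toFinite _)
    rw [Set.ssubset_iff_of_subset Set.diff_subset]
    obtain ⟨s, hs⟩ := hSne
    exact ⟨s, hSD hs, fun h => h.2 hs⟩
  have hgood' : ∀ Y, IsComp G (D \ S) Y → Good G r n Y := by
    intro Y hY
    by_cases hYX : (Y ∩ X).Nonempty
    · have hsub : Y ⊆ X := conn_sub hY.conn
        (fun x hx y hy hxy => hX.closed x hx y (hY.sub hy).1 hxy) hYX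
      refine ⟨U, M, f, J, hpre.mono hsub ?_ (fun y hy => ⟨hsub hy, (hY.sub hy).2⟩)⟩
      rintro z ⟨hz, c, hc, hzc⟩
      by_cases hzX : z ∈ X
      · by_cases hzS : z ∈ S
        · exact Or.inr hzS
        · exact absurd (hY.closed c hc z ⟨hX.sub hzX, hzS⟩ hzc.symm) hz
      · exact Or.inl ⟨hzX, c, hsub hc, hzc⟩
    · refine hgood Y ⟨fun y hy => (hY.sub hy).1, hY.conn, ?_⟩
      intro x hx y hy hxy
      by_cases hyS : y ∈ S
      · exact absurd ⟨x, hx, hX.closed y (hSX hyS) x (hY.sub hx).1 hxy.symm⟩ hYX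
      · exact hY.closed x hx y ⟨hy, hyS⟩ hxy
  obtain ⟨ρ, hρi, hρ⟩ := ih _ hlt (D \ S) rfl hgood'
  let e := Fintype.equivFin V
  let N := Fintype.card V
  have heN : ∀ v, (e v : ℕ) < N := fun v => (e v).2
  let ρ' : V → ℕ := fun v => if v ∈ S then (e v : ℕ) else N + ρ v
  have hρ'S : ∀ v ∈ S, ρ' v < N := by
    intro v hv; simp only [ρ', if_pos hv]; exact heN v
  have hρ'n : ∀ v, v ∉ S → ρ' v = N + ρ v := by
    intro v hv; simp only [ρ', if_neg hv]
  refine ⟨ρ', ?_, ?_⟩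
  · intro u hu v hv huv
    by_cases hus : u ∈ S <;> by_cases hvs : v ∈ S
    · simp only [ρ', if_pos hus, if_pos hvs] at huv
      exact e.injective (Fin.ext huv)
    · have := hρ'S u hus; have := hρ'n v hvs; omega
    · have := hρ'S v hvs; have := hρ'n u hus; omega
    · rw [hρ'n u hus, hρ'n v hvs] at huv
      exact hρi ⟨hu, hus⟩ ⟨hv, hvs⟩ (by omega)
  · intro v hv
    by_cases hvs : v ∈ S
    · refine le_trans (Set.ncard_le_ncard ?_ (Set.toFinite _)) (hpre.count v (hSX hvs))
      rintro u ⟨hu, hru⟩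
      have h1 : Rch G D r v u := hru.mono (by
        rintro w (rfl | hw)
        · exact hv
        · exact hw.1)
      have h2 : Rch G X r v u := h1.restrict hX.closed (fun _ => hSX hvs)
      refine ⟨?_, h2⟩
      rcases h2.mem_nb (Or.inl (hSX hvs)) with h3 | h3
      · right
        by_contra hus
        have a1 := hu (hX.sub h3)
        have a2 := hρ'S v hvs
        have a3 := hρ'n u hus
        omega
      · exact Or.inl h3
    · refine le_trans (Set.ncard_le_ncard ?_ (Set.toFinite _)) (hρ v ⟨hv, hvs⟩)
      rintro u ⟨hu, hru⟩
      have hv' := hρ'n v hvs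
      constructor
      · rintro ⟨huD, hus⟩
        have a1 := hu huD
        have a3 := hρ'n u hus
        omega
      · refine hru.mono ?_
        rintro w (rfl | ⟨hw1, hw2⟩)
        · exact Or.inl rfl
        · right
          have hws : w ∉ S := fun hws => by
            have := hρ'S w hws; omega
          have := hρ'n w hws
          exact ⟨⟨hw1, hws⟩, by omega⟩

end KtCol

/-- **Corollary.** For `t ≥ 3`, every graph excluding `K_t` as a minor
satisfies `col_r(G) ≤ C(t−1,2)·(2r+1)`. -/
theorem col_le_of_Kt_minor_free (t : ℕ) (ht : 3 ≤ t)
    (G : SimpleGraph V) (hG : ¬ HasKtMinor G t) (r : ℕ) :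
    col G r ≤ (t - 1).choose 2 * (2 * r + 1) := by
  classical
  obtain ⟨n, rfl⟩ : ∃ n, t = n + 1 := ⟨t - 1, by omega⟩
  have hn : 2 ≤ n := by omega
  rw [Nat.add_sub_cancel]
  rcases Nat.eq_zero_or_pos r with rfl | hr
  · refine Nat.sInf_le ⟨LinearOrder.lift' (Fintype.equivFin V) (Fintype.equivFin V).injective, ?_⟩
    intro v
    refine le_trans (Set.ncard_le_ncard (t := {v}) ?_ (Set.toFinite _)) ?_
    · rintro u ⟨p, _, hp, _⟩
      exact (SimpleGraph.Walk.eq_of_length_eq_zero (Nat.le_zero.1 hp)).symm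
    · rw [Set.ncard_singleton]
      have := Nat.choose_pos hn
      omega
  · have hinit : ∀ X, KtCol.IsComp G Set.univ X → KtCol.Good G r n X := by
      intro X hX
      obtain ⟨x, hx⟩ := hX.nonempty
      have hNb : ∀ z, z ∉ KtCol.Nb G X := by
        rintro z ⟨hz, c, hc, hzc⟩
        exact hz (hX.closed c hc z (Set.mem_univ _) hzc.symm)
      refine ⟨fun _ => ∅, fun _ _ => ∅, fun _ _ => x, fun _ _ => False, ?_⟩
      refine { conn := ?_, Jne := ?_, Jsymm := ?_, Jf := ?_, Jlp := ?_, nJ := ?_, Msymm := ?_,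
               dU := ?_, dMU := ?_, dMM := ?_, dUW := ?_, dMW := ?_, cov := ?_, covU := ?_,
               flat := fun _ _ _ => KtCol.flat_pair hr _ _ _ }
      all_goals simp [hNb]
    obtain ⟨ρ, hρi, hρ⟩ := KtCol.order_exists hr hn hG _ Set.univ rfl hinit
    have hinj : Function.Injective ρ := Set.injOn_univ.1 hρi
    refine Nat.sInf_le ⟨LinearOrder.lift' ρ hinj, ?_⟩
    intro v
    refine le_trans (Set.ncard_le_ncard ?_ (Set.toFinite _)) (hρ v (Set.mem_univ _))
    rintro u ⟨p, hp, hl, huv, hw⟩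
    refine ⟨fun _ => huv, KtCol.Rch.of_walk p hp hl ?_⟩
    intro w hws hwu
    by_cases hwv : w = v
    · exact Or.inl hwv
    · exact Or.inr ⟨Set.mem_univ _, hw w hws hwu hwv⟩
end

section
/- For every finite planar graph G and every r ≥ 1, wcol_r(G) ≤ C(r+2, 2)·(2r+1), where C(r+2,2) = (r+2)(r+1)/2. -/
open SimpleGraph

variable {V : Type} [Fintype V]

/-- `G` contains `H` as a minor: disjoint nonempty connected branch sets, with
an edge of `G` between the branch sets of every pair of adjacent vertices of
`H`. -/
def HasMinor {W : Type} (G : SimpleGraph V) (H : SimpleGraph W) : Prop :=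
  ∃ B : W → Set V, (∀ i, (B i).Nonempty) ∧ (∀ i, (G.induce (B i)).Connected) ∧
    (∀ i j, i ≠ j → Disjoint (B i) (B j)) ∧
    ∀ i j, H.Adj i j → ∃ u ∈ B i, ∃ v ∈ B j, G.Adj u v

/-- `G` is planar (Wagner): it excludes both `K₅` and `K₃,₃` as minors. -/
def IsPlanar (G : SimpleGraph V) : Prop :=
  ¬ HasMinor G (⊤ : SimpleGraph (Fin 5)) ∧
  ¬ HasMinor G (completeBipartiteGraph (Fin 3) (Fin 3))


set_option linter.unusedSectionVars false
set_option linter.unusedVariables false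

namespace WC
variable {G : SimpleGraph V}

def Ad (G : SimpleGraph V) (X Y : Set V) : Prop := ∃ u ∈ X, ∃ v ∈ Y, G.Adj u v

def Cn (G : SimpleGraph V) (S : Set V) : Prop :=
  S.Nonempty ∧ ∀ X ⊆ S, X.Nonempty → (∀ u ∈ X, ∀ v ∈ S, G.Adj u v → v ∈ X) → S ⊆ X

def comp (G : SimpleGraph V) (S : Set V) (v : V) : Set V :=
  {u | ∃ X ⊆ S, Cn G X ∧ v ∈ X ∧ u ∈ X}

theorem Ad.symm {X Y : Set V} (h : Ad G X Y) : Ad G Y X := by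
  obtain ⟨u, hu, v, hv, h⟩ := h
  exact ⟨v, hv, u, hu, h.symm⟩

theorem Ad.mono {X Y X' Y' : Set V} (h : Ad G X Y) (h1 : X ⊆ X') (h2 : Y ⊆ Y') : Ad G X' Y' := by
  obtain ⟨u, hu, v, hv, h⟩ := h
  exact ⟨u, h1 hu, v, h2 hv, h⟩

theorem Cn.singleton (v : V) : Cn G {v} := by
  refine ⟨⟨v, rfl⟩, fun X hX hne _ => ?_⟩
  obtain ⟨w, hw⟩ := hne
  have := hX hw
  simp at this ⊢
  exact this ▸ hw

theorem Cn.union {X Y : Set V} (hX : Cn G X) (hY : Cn G Y) (h : (X ∩ Y).Nonempty ∨ Ad G X Y) :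
    Cn G (X ∪ Y) := by
  refine ⟨hX.1.mono Set.subset_union_left, fun Z hZ hne hcl => ?_⟩
  have h1 : (Z ∩ X).Nonempty → X ⊆ Z := fun hn =>
    (hX.2 (Z ∩ X) Set.inter_subset_right hn
      (fun u hu v hv huv => ⟨hcl u hu.1 v (Or.inl hv) huv, hv⟩)).trans Set.inter_subset_left
  have h2 : (Z ∩ Y).Nonempty → Y ⊆ Z := fun hn =>
    (hY.2 (Z ∩ Y) Set.inter_subset_right hn
      (fun u hu v hv huv => ⟨hcl u hu.1 v (Or.inr hv) huv, hv⟩)).trans Set.inter_subset_left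
  have h3 : X ⊆ Z → (Z ∩ Y).Nonempty := by
    intro hh
    rcases h with ⟨w, hw⟩ | ⟨u, hu, v, hv, huv⟩
    · exact ⟨w, hh hw.1, hw.2⟩
    · exact ⟨v, hcl u (hh hu) v (Or.inr hv) huv, hv⟩
  have h4 : Y ⊆ Z → (Z ∩ X).Nonempty := by
    intro hh
    rcases h with ⟨w, hw⟩ | ⟨u, hu, v, hv, huv⟩
    · exact ⟨w, hh hw.2, hw.1⟩
    · exact ⟨u, hcl v (hh hv) u (Or.inl hu) huv.symm, hu⟩
  obtain ⟨z, hz⟩ := hne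
  rcases hZ hz with hx | hy
  · have := h1 ⟨z, hz, hx⟩
    exact Set.union_subset this (h2 (h3 this))
  · have := h2 ⟨z, hz, hy⟩
    exact Set.union_subset (h1 (h4 this)) this

/-- leaving edge -/
theorem Cn.exit {S X : Set V} (hS : Cn G S) (h1 : (S ∩ X).Nonempty) (h2 : ¬ S ⊆ X) :
    ∃ u ∈ S, u ∈ X ∧ ∃ v ∈ S, v ∉ X ∧ G.Adj u v := by
  by_contra hcon
  push Not at hcon
  apply h2
  refine (hS.2 (S ∩ X) Set.inter_subset_left h1 ?_).trans Set.inter_subset_right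
  intro u hu v hv huv
  refine ⟨hv, ?_⟩
  by_contra hvX
  exact hcon u hu.1 hu.2 v hv hvX huv

theorem Cn.star {p S : Set V} (hp : Cn G p)
    (h : ∀ s ∈ S, ∃ X ⊆ S, Cn G X ∧ s ∈ X ∧ Ad G X p) : Cn G (p ∪ S) := by
  refine ⟨hp.1.mono Set.subset_union_left, fun Z hZ hne hcl => ?_⟩
  have key : ∀ Y ⊆ p ∪ S, Cn G Y → (Z ∩ Y).Nonempty → Y ⊆ Z := fun Y hYS hY hn =>
    (hY.2 (Z ∩ Y) Set.inter_subset_right hn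
      (fun u hu v hv huv => ⟨hcl u hu.1 v (hYS hv) huv, hv⟩)).trans Set.inter_subset_left
  have hpZ : p ⊆ Z := by
    apply key p Set.subset_union_left hp
    obtain ⟨z, hz⟩ := hne
    rcases hZ hz with hx | hy
    · exact ⟨z, hz, hx⟩
    · obtain ⟨X, hXS, hX, hzX, u, hu, v, hv, huv⟩ := h z hy
      have := key X (hXS.trans Set.subset_union_right) hX ⟨z, hz, hzX⟩
      exact ⟨v, hcl u (this hu) v (Or.inl hv) huv, hv⟩
  refine Set.union_subset hpZ fun s hs => ?_
  obtain ⟨X, hXS, hX, hzX, u, hu, v, hv, huv⟩ := h s hs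
  exact key X (hXS.trans Set.subset_union_right) hX
    ⟨u, hcl v (hpZ hv) u (Or.inr (hXS hu)) huv.symm, hu⟩ hzX

theorem comp_sub {S : Set V} {v : V} : comp G S v ⊆ S := by
  rintro u ⟨X, hX, _, _, hu⟩
  exact hX hu

theorem mem_comp {S : Set V} {v : V} (h : v ∈ S) : v ∈ comp G S v :=
  ⟨{v}, by simpa using h, Cn.singleton v, rfl, rfl⟩

theorem sub_comp {S X : Set V} {v : V} (h : X ⊆ S) (hX : Cn G X) (hv : v ∈ X) :
    X ⊆ comp G S v := fun u hu => ⟨X, h, hX, hv, hu⟩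

theorem comp_cn {S : Set V} {v : V} (h : v ∈ S) : Cn G (comp G S v) := by
  refine ⟨⟨v, mem_comp h⟩, fun Z hZ hne hcl => ?_⟩
  have key : ∀ Y ⊆ comp G S v, Cn G Y → (Z ∩ Y).Nonempty → Y ⊆ Z := fun Y hYS hY hn =>
    (hY.2 (Z ∩ Y) Set.inter_subset_right hn
      (fun u hu v hv huv => ⟨hcl u hu.1 v (hYS hv) huv, hv⟩)).trans Set.inter_subset_left
  have hvZ : v ∈ Z := by
    obtain ⟨z, hz⟩ := hne
    obtain ⟨X, hXS, hX, hvX, hzX⟩ := hZ hz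
    exact key X (sub_comp hXS hX hvX) hX ⟨z, hz, hzX⟩ hvX
  rintro u ⟨X, hXS, hX, hvX, hzX⟩
  exact key X (sub_comp hXS hX hvX) hX ⟨v, hvZ, hvX⟩ hzX

theorem comp_closed {S : Set V} {v u w : V} (h : u ∈ comp G S v) (hw : w ∈ S) (ha : G.Adj u w) :
    w ∈ comp G S v := by
  obtain ⟨X, hXS, hX, hvX, hzX⟩ := h
  refine ⟨X ∪ {w}, Set.union_subset hXS (by simpa using hw), hX.union (Cn.singleton w)
    (Or.inr ⟨u, hzX, w, rfl, ha⟩), Or.inl hvX, Or.inr rfl⟩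

theorem comp_eq {S : Set V} {v u : V} (h : u ∈ comp G S v) : comp G S u = comp G S v := by
  obtain ⟨X, hXS, hX, hvX, huX⟩ := h
  have hv := hXS hvX
  have hu := hXS huX
  have huv : u ∈ comp G S v := ⟨X, hXS, hX, hvX, huX⟩
  apply Set.Subset.antisymm
  · have : Cn G (comp G S u ∪ comp G S v) :=
      (comp_cn hu).union (comp_cn hv) (Or.inl ⟨u, mem_comp hu, huv⟩)
    exact Set.subset_union_left.trans
      (sub_comp (Set.union_subset comp_sub comp_sub) this (Or.inr (mem_comp hv)))
  · exact sub_comp comp_sub (comp_cn hv) huv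

theorem Cn.connected {S : Set V} (h : Cn G S) : (G.induce S).Connected := by
  obtain ⟨⟨v, hv⟩, h⟩ := h
  have key : ∀ u (hu : u ∈ S), (G.induce S).Reachable ⟨v, hv⟩ ⟨u, hu⟩ := by
    have := h {u | ∃ hu : u ∈ S, (G.induce S).Reachable ⟨v, hv⟩ ⟨u, hu⟩}
      (by rintro u ⟨hu, _⟩; exact hu) ⟨v, hv, Reachable.refl _⟩ (by
        rintro u ⟨hu, hr⟩ w hw ha
        refine ⟨hw, hr.trans (Adj.reachable ?_)⟩
        simpa using ha)
    intro u hu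
    exact (this hu).2
  have : Nonempty S := ⟨⟨v, hv⟩⟩
  exact Connected.mk (fun a b => (key a a.2).symm.trans (key b b.2))

theorem no_k33 (hG : IsPlanar G) {a b c d e f : Set V}
    (ha : Cn G a) (hb : Cn G b) (hc : Cn G c) (hd : Cn G d) (he : Cn G e) (hf : Cn G f)
    (hab : Disjoint a b) (hac : Disjoint a c) (hbc : Disjoint b c)
    (hde : Disjoint d e) (hdf : Disjoint d f) (hef : Disjoint e f)
    (had : Disjoint a d) (hae : Disjoint a e) (haf : Disjoint a f)
    (hbd : Disjoint b d) (hbe : Disjoint b e) (hbf : Disjoint b f)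
    (hcd : Disjoint c d) (hce : Disjoint c e) (hcf : Disjoint c f)
    (xad : Ad G a d) (xae : Ad G a e) (xaf : Ad G a f)
    (xbd : Ad G b d) (xbe : Ad G b e) (xbf : Ad G b f)
    (xcd : Ad G c d) (xce : Ad G c e) (xcf : Ad G c f) : False := by
  apply hG.2
  have hcn : ∀ i : Fin 3 ⊕ Fin 3, Cn G (Sum.elim ![a, b, c] ![d, e, f] i) := by
    rintro (i | i) <;> fin_cases i <;> simpa
  refine ⟨Sum.elim ![a, b, c] ![d, e, f], fun i => (hcn i).1, fun i => (hcn i).connected, ?_, ?_⟩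
  · rintro (i | i) (j | j) hij <;> fin_cases i <;> fin_cases j <;>
      simp at hij ⊢ <;> first | assumption | (rw [disjoint_comm]; assumption)
  · have : ∀ i j : Fin 3, Ad G (![a, b, c] i) (![d, e, f] j) := by
      intro i j
      fin_cases i <;> fin_cases j <;> simpa
    rintro (i | i) (j | j) hij
    · simp at hij
    · exact this i j
    · exact (this j i).symm
    · simp at hij

theorem no_k5 (hG : IsPlanar G) {a b c d e : Set V}
    (ha : Cn G a) (hb : Cn G b) (hc : Cn G c) (hd : Cn G d) (he : Cn G e)
    (hab : Disjoint a b) (hac : Disjoint a c) (had : Disjoint a d) (hae : Disjoint a e)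
    (hbc : Disjoint b c) (hbd : Disjoint b d) (hbe : Disjoint b e)
    (hcd : Disjoint c d) (hce : Disjoint c e) (hde : Disjoint d e)
    (xab : Ad G a b) (xac : Ad G a c) (xad : Ad G a d) (xae : Ad G a e)
    (xbc : Ad G b c) (xbd : Ad G b d) (xbe : Ad G b e)
    (xcd : Ad G c d) (xce : Ad G c e) (xde : Ad G d e) : False := by
  apply hG.1
  have hcn : ∀ i : Fin 5, Cn G (![a, b, c, d, e] i) := by
    intro i; fin_cases i <;> simpa
  refine ⟨![a, b, c, d, e], fun i => (hcn i).1, fun i => (hcn i).connected, ?_, ?_⟩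
  · intro i j hij
    fin_cases i <;> fin_cases j <;>
      simp at hij ⊢ <;> first | assumption | (rw [disjoint_comm]; assumption)
  · intro i j hij
    show Ad G _ _
    fin_cases i <;> fin_cases j <;>
      simp at hij ⊢ <;> first | assumption | (apply Ad.symm; assumption)

/-! minimal sets -/

def Fam (G : SimpleGraph V) (C p q X : Set V) : Prop :=
  X ⊆ C ∧ Cn G X ∧ (C \ X = ∅ ∨ Cn G (C \ X)) ∧ Ad G X p ∧ Ad G X q

def side (G : SimpleGraph V) (M : Set V) (x : V) (p : Set V) : Set V :=
  {m | m ∈ M \ {x} ∧ Ad G (comp G (M \ {x}) m) p}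

theorem comp_adj_x {M : Set V} (hM : Cn G M) {x m : V} (hx : x ∈ M) (hm : m ∈ M \ {x}) :
    Ad G (comp G (M \ {x}) m) {x} := by
  obtain ⟨u, hu, huX, v, hv, hvX, huv⟩ := hM.exit (X := comp G (M \ {x}) m)
    ⟨m, hm.1, mem_comp hm⟩ (fun h => (comp_sub (h hx)).2 rfl)
  refine ⟨u, huX, v, ?_, huv⟩
  by_contra hvx
  exact hvX (comp_closed huX ⟨hv, hvx⟩ huv)

/-- removing one component of `M \ x` from `M` and gluing with any connected set containing `x`. -/
theorem star_rest {M P : Set V} (hM : Cn G M) {x : V} (hx : x ∈ M) (hP : Cn G P) (hxP : x ∈ P)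
    (Z : Set V) (hZ : ∀ m ∈ M \ {x}, m ∉ Z → Disjoint (comp G (M \ {x}) m) Z) :
    Cn G (P ∪ ((M \ {x}) \ Z)) := by
  apply hP.star
  intro s hs
  refine ⟨comp G (M \ {x}) s, fun u hu => ⟨comp_sub hu, ?_⟩, comp_cn hs.1, mem_comp hs.1,
    (comp_adj_x hM hx hs.1).mono subset_rfl (by simpa using hxP)⟩
  exact fun huZ => Set.disjoint_left.1 (hZ s hs.1 hs.2) hu huZ

theorem comp_disj {S : Set V} {z m : V} (hm : m ∉ comp G S z) :
    Disjoint (comp G S m) (comp G S z) := by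
  rw [Set.disjoint_left]
  intro u hu hu'
  by_cases hmS : m ∈ S
  · rw [← comp_eq hu', comp_eq hu] at hm
    exact hm (mem_comp hmS)
  · obtain ⟨X, hXS, _, h, _⟩ := hu
    exact hmS (hXS h)

theorem min_sep {C p q M : Set V} (hM : Minimal (Fam G C p q) M) {x k : V} (hx : x ∈ M)
    (hk : k ∈ C \ M) (hxk : G.Adj x k) {m : V} (hm : m ∈ M \ {x})
    (h1 : Ad G (comp G (M \ {x}) m) p) (h2 : Ad G (comp G (M \ {x}) m) q) : False := by
  obtain ⟨hMC, hMc, hK, -, -⟩ := hM.1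
  have hK : Cn G (C \ M) := hK.resolve_left (fun h => by rw [h] at hk; exact hk)
  set Z := comp G (M \ {x}) m with hZ
  have hZM : Z ⊆ M := comp_sub.trans Set.sdiff_subset
  have hxZ : x ∉ Z := fun h => (comp_sub h).2 rfl
  have : Cn G (C \ Z) := by
    have h := star_rest hMc hx (hK.union (Cn.singleton x) (Or.inr ⟨k, hk, x, rfl, hxk.symm⟩))
      (Or.inr rfl) Z (fun m' _ h => comp_disj h)
    convert h using 1
    ext u
    have := @hZM u
    have := @hMC u
    by_cases hux : u = x
    · subst hux; simp_all
    · simp only [Set.mem_sdiff, Set.mem_union, Set.mem_singleton_iff]; tauto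
  exact hxZ (hM.2 ⟨hZM.trans hMC, comp_cn hm, Or.inr this, h1, h2⟩ hZM hx)

theorem min_nb {C p q M : Set V} (hM : Minimal (Fam G C p q) M) {x : V} (hx : x ∈ M)
    {m k : V} (hm : m ∈ M) (hk : k ∈ C \ M) (hmk : G.Adj m k) :
    m = x ∨ m ∈ side G M x p ∨ m ∈ side G M x q := by
  by_contra hcon
  push Not at hcon
  obtain ⟨hmx, hm1, hm2⟩ := hcon
  have hmm : m ∈ M \ {x} := ⟨hm, hmx⟩
  obtain ⟨hMC, hMc, hK, h1, h2⟩ := hM.1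
  have hK : Cn G (C \ M) := hK.resolve_left (fun h => by rw [h] at hk; exact hk)
  set Z := comp G (M \ {x}) m with hZ
  have hZM : Z ⊆ M := comp_sub.trans Set.sdiff_subset
  have hxZ : x ∉ Z := fun h => (comp_sub h).2 rfl
  have e1 : Cn G (M \ Z) := by
    have h := star_rest hMc hx (Cn.singleton x) rfl Z (fun m' _ h => comp_disj h)
    convert h using 1
    ext u
    by_cases hux : u = x
    · subst hux; simp_all
    · simp only [Set.mem_sdiff, Set.mem_union, Set.mem_singleton_iff]; tauto
  have e2 : Cn G (C \ (M \ Z)) := by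
    have h := hK.union (comp_cn hmm) (Or.inr ⟨k, hk, m, mem_comp hmm, hmk.symm⟩)
    convert h using 1
    ext u
    have := @hZM u
    have := @hMC u
    simp only [Set.mem_sdiff, Set.mem_union, ← hZ]; tauto
  have e3 : ∀ p, Ad G M p → m ∉ side G M x p → Ad G (M \ Z) p := by
    rintro p ⟨u, hu, v, hv, huv⟩ hms
    refine ⟨u, ⟨hu, fun huZ => hms ⟨hmm, u, huZ, v, hv, huv⟩⟩, v, hv, huv⟩
  have := hM.2 ⟨Set.sdiff_subset.trans hMC, e1, Or.inr e2, e3 p h1 hm1, e3 q h2 hm2⟩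
    Set.sdiff_subset hm
  exact this.2 (mem_comp hmm)

theorem Fam.swap {C p q X : Set V} (h : Fam G C p q X) : Fam G C q p X :=
  ⟨h.1, h.2.1, h.2.2.1, h.2.2.2.2, h.2.2.2.1⟩

theorem min_swap {C p q X : Set V} (h : Minimal (Fam G C p q) X) : Minimal (Fam G C q p) X :=
  ⟨h.1.swap, fun _ hY => h.2 hY.swap⟩

structure Cfg (G : SimpleGraph V) (C p q M N : Set V) (x y : V) (E : Set V) : Prop where
  cp : Cn G p
  cq : Cn G q
  pq : Ad G p q
  dpq : Disjoint p q
  dpC : Disjoint p C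
  dqC : Disjoint q C
  MC : M ⊆ C
  NC : N ⊆ C
  dMN : Disjoint M N
  cM : Cn G M
  cN : Cn G N
  Mp : Ad G M p
  Mq : Ad G M q
  Np : Ad G N p
  Nq : Ad G N q
  cCM : Cn G (C \ M)
  cCN : Cn G (C \ N)
  xM : x ∈ M
  yN : y ∈ N
  sM : Disjoint (side G M x p) (side G M x q)
  sN : Disjoint (side G N y p) (side G N y q)
  nM : ∀ m ∈ M, ∀ k ∈ C \ M, G.Adj m k → m = x ∨ m ∈ side G M x p ∨ m ∈ side G M x q
  nN : ∀ m ∈ N, ∀ k ∈ C \ N, G.Adj m k → m = y ∨ m ∈ side G N y p ∨ m ∈ side G N y q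
  EC : E ⊆ (C \ M) \ N
  hE : (E = ∅ ∧ G.Adj x y) ∨ (Cn G E ∧ Ad G {x} E ∧ Ad G E {y})

variable {C p q M N E : Set V} {x y : V}

theorem Cfg.swapPQ (h : Cfg G C p q M N x y E) : Cfg G C q p M N x y E where
  cp := h.cq
  cq := h.cp
  pq := h.pq.symm
  dpq := h.dpq.symm
  dpC := h.dqC
  dqC := h.dpC
  MC := h.MC
  NC := h.NC
  dMN := h.dMN
  cM := h.cM
  cN := h.cN
  Mp := h.Mq
  Mq := h.Mp
  Np := h.Nq
  Nq := h.Np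
  cCM := h.cCM
  cCN := h.cCN
  xM := h.xM
  yN := h.yN
  sM := h.sM.symm
  sN := h.sN.symm
  nM := fun m hm k hk ha => by have := h.nM m hm k hk ha; tauto
  nN := fun m hm k hk ha => by have := h.nN m hm k hk ha; tauto
  EC := h.EC
  hE := h.hE

theorem Cfg.swapMN (h : Cfg G C p q M N x y E) : Cfg G C p q N M y x E where
  cp := h.cp
  cq := h.cq
  pq := h.pq
  dpq := h.dpq
  dpC := h.dpC
  dqC := h.dqC
  MC := h.NC
  NC := h.MC
  dMN := h.dMN.symm
  cM := h.cN
  cN := h.cM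
  Mp := h.Np
  Mq := h.Nq
  Np := h.Mp
  Nq := h.Mq
  cCM := h.cCN
  cCN := h.cCM
  xM := h.yN
  yN := h.xM
  sM := h.sN
  sN := h.sM
  nM := h.nN
  nN := h.nM
  EC := fun u hu => ⟨⟨(h.EC hu).1.1, (h.EC hu).2⟩, (h.EC hu).1.2⟩
  hE := by
    rcases h.hE with ⟨a, b⟩ | ⟨a, b, c⟩
    · exact Or.inl ⟨a, b.symm⟩
    · exact Or.inr ⟨a, c.symm, b.symm⟩

theorem side_sub : side G M x p ⊆ M \ {x} := fun m hm => hm.1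

theorem side_star (P : Set V) (hP : Cn G P) (h : p ⊆ P) : Cn G (P ∪ side G M x p) := by
  apply hP.star
  intro s hs
  refine ⟨comp G (M \ {x}) s, fun u hu => ⟨comp_sub hu, ?_⟩, comp_cn hs.1, mem_comp hs.1,
    hs.2.mono subset_rfl h⟩
  rw [comp_eq hu]
  exact hs.2

theorem side_star_x (hM : Cn G M) (hx : x ∈ M) : Cn G ({x} ∪ side G M x p) := by
  apply (Cn.singleton x).star
  intro s hs
  refine ⟨comp G (M \ {x}) s, fun u hu => ⟨comp_sub hu, ?_⟩, comp_cn hs.1, mem_comp hs.1,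
    comp_adj_x hM hx hs.1⟩
  rw [comp_eq hu]
  exact hs.2

theorem comp_side {m : V} (hm : m ∈ side G M x p) : comp G (M \ {x}) m ⊆ side G M x p := by
  intro u hu
  refine ⟨comp_sub hu, ?_⟩
  rw [comp_eq hu]
  exact hm.2

/-- `x` is adjacent to `p ∪ Mp`. -/
theorem x_adj (hM : Cn G M) (hx : x ∈ M) (hp : Ad G M p) : Ad G {x} (p ∪ side G M x p) := by
  obtain ⟨u, hu, v, hv, huv⟩ := hp
  by_cases hux : u = x
  · exact ⟨x, rfl, v, Or.inl hv, hux ▸ huv⟩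
  · have hm : u ∈ M \ {x} := ⟨hu, hux⟩
    have hs : u ∈ side G M x p := ⟨hm, u, mem_comp hm, v, hv, huv⟩
    exact (comp_adj_x hM hx hm).symm.mono subset_rfl ((comp_side hs).trans Set.subset_union_right)

theorem xs_adj (hM : Cn G M) (hx : x ∈ M) (hp : Ad G M p) : Ad G p ({x} ∪ side G M x p) := by
  obtain ⟨u, hu, v, hv, huv⟩ := hp
  by_cases hux : u = x
  · exact ⟨v, hv, x, Or.inl rfl, (hux ▸ huv).symm⟩
  · have hm : u ∈ M \ {x} := ⟨hu, hux⟩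
    exact ⟨v, hv, u, Or.inr ⟨hm, u, mem_comp hm, v, hv, huv⟩, huv.symm⟩

theorem Cfg.cyE (h : Cfg G C p q M N x y E) : Cn G ({y} ∪ E) := by
  rcases h.hE with ⟨a, b⟩ | ⟨a, b, c⟩
  · rw [a, Set.union_empty]; exact Cn.singleton y
  · exact (Cn.singleton y).union a (Or.inr c.symm)

theorem Cfg.xyE (h : Cfg G C p q M N x y E) : Ad G {x} ({y} ∪ E) := by
  rcases h.hE with ⟨a, b⟩ | ⟨a, b, c⟩
  · exact ⟨x, rfl, y, Or.inl rfl, b⟩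
  · exact b.mono subset_rfl Set.subset_union_right

theorem Cfg.pt (h : Cfg G C p q M N x y E) (u : V) :
    (u ∈ p → u ∉ C) ∧ (u ∈ q → u ∉ C) ∧ (u ∈ p → u ∉ q) ∧ (u ∈ M → u ∈ C) ∧ (u ∈ N → u ∈ C) ∧
    (u ∈ M → u ∉ N) ∧ (u ∈ side G M x p → u ∈ M ∧ u ≠ x) ∧ (u ∈ side G M x q → u ∈ M ∧ u ≠ x) ∧
    (u ∈ side G N y p → u ∈ N ∧ u ≠ y) ∧ (u ∈ side G N y q → u ∈ N ∧ u ≠ y) ∧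
    (u ∈ side G M x p → u ∉ side G M x q) ∧ (u ∈ side G N y p → u ∉ side G N y q) ∧
    (u ∈ E → u ∈ C ∧ u ∉ M ∧ u ∉ N) ∧ (u = x → u ∈ M) ∧ (u = y → u ∈ N) :=
  ⟨fun a b => Set.disjoint_left.1 h.dpC a b, fun a b => Set.disjoint_left.1 h.dqC a b,
   fun a b => Set.disjoint_left.1 h.dpq a b, @h.MC u, @h.NC u,
   fun a b => Set.disjoint_left.1 h.dMN a b, fun a => ⟨(side_sub a).1, (side_sub a).2⟩,
   fun a => ⟨(side_sub a).1, (side_sub a).2⟩, fun a => ⟨(side_sub a).1, (side_sub a).2⟩,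
   fun a => ⟨(side_sub a).1, (side_sub a).2⟩, fun a b => Set.disjoint_left.1 h.sM a b,
   fun a b => Set.disjoint_left.1 h.sN a b,
   fun a => ⟨(h.EC a).1.1, (h.EC a).1.2, (h.EC a).2⟩, fun a => a ▸ h.xM, fun a => a ▸ h.yN⟩

/-- hexagon configuration -/
theorem Cfg.hex (hG : IsPlanar G) (h : Cfg G C p q M N x y E) {D : Set V} {m n : V}
    (hm : m ∈ side G M x q) (hn : n ∈ side G N y p)
    (hW : Cn G (comp G (N \ {y}) n ∪ D)) (hD : D ⊆ ((C \ M) \ N) \ E)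
    (ha : Ad G (comp G (M \ {x}) m) (comp G (N \ {y}) n ∪ D)) : False := by
  have pt := h.pt
  have s1 : comp G (M \ {x}) m ⊆ side G M x q := comp_side hm
  have s2 : comp G (N \ {y}) n ⊆ side G N y p := comp_side hn
  have cZ' : Cn G (comp G (M \ {x}) m) := comp_cn hm.1
  have aZ'q := hm.2
  have aZ'x := comp_adj_x h.cM h.xM hm.1
  have aZp := hn.2
  have aZy := comp_adj_x h.cN h.yN hn.1
  set Z' := comp G (M \ {x}) m
  set Z := comp G (N \ {y}) n
  have dj : ∀ A B : Set V, (∀ u, u ∈ A → u ∈ B → False) → Disjoint A B :=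
    fun A B hh => Set.disjoint_left.2 hh
  refine no_k33 hG (a := p) (b := Z') (c := {y} ∪ E) (d := {x} ∪ side G M x p)
    (e := q ∪ side G N y q) (f := Z ∪ D) h.cp cZ' h.cyE (side_star_x h.cM h.xM)
    (side_star q h.cq subset_rfl) hW ?_ ?_ ?_ ?_ ?_ ?_ ?_ ?_ ?_ ?_ ?_ ?_ ?_ ?_ ?_
    (xs_adj h.cM h.xM h.Mp) (h.pq.mono subset_rfl Set.subset_union_left)
    (aZp.symm.mono subset_rfl Set.subset_union_left)
    (aZ'x.mono subset_rfl Set.subset_union_left) (aZ'q.mono subset_rfl Set.subset_union_left) ha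
    (h.xyE.symm.mono subset_rfl Set.subset_union_left)
    ((x_adj h.cN h.yN h.Nq).mono Set.subset_union_left subset_rfl)
    (aZy.symm.mono Set.subset_union_left Set.subset_union_left)
  all_goals
    apply dj
    intro u h1 h2
    have := pt u
    have := @s1 u
    have := @s2 u
    have := @hD u
    simp only [Set.mem_union, Set.mem_singleton_iff, Set.mem_sdiff] at *
    grind

theorem Cfg.case2 (hG : IsPlanar G) (h : Cfg G C p q M N x y E) {D : Set V} (cD : Cn G D)
    (hD : D ⊆ ((C \ M) \ N) \ E) (aQ : Ad G D (q ∪ side G M x q ∪ side G N y q))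
    (aM : Ad G D M) (aN : Ad G D (side G N y p)) : False := by
  obtain ⟨d, hd, n, hn, hdn⟩ := aN
  have pt := h.pt
  have s2 : comp G (N \ {y}) n ⊆ side G N y p := comp_side hn
  have aZp := hn.2
  have aZy := comp_adj_x h.cN h.yN hn.1
  have cZ : Cn G (comp G (N \ {y}) n) := comp_cn hn.1
  have aZD : Ad G (comp G (N \ {y}) n) D := ⟨n, mem_comp hn.1, d, hd, hdn.symm⟩
  by_cases aX : Ad G D ({x} ∪ side G M x p)
  · have dj : ∀ A B : Set V, (∀ u, u ∈ A → u ∈ B → False) → Disjoint A B :=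
      fun A B hh => Set.disjoint_left.2 hh
    set Z := comp G (N \ {y}) n
    have cQ : Cn G (q ∪ side G M x q ∪ side G N y q) :=
      side_star _ (side_star q h.cq subset_rfl) Set.subset_union_left
    refine no_k33 hG (a := D) (b := p) (c := {y} ∪ E) (d := Z) (e := {x} ∪ side G M x p)
      (f := q ∪ side G M x q ∪ side G N y q) cD h.cp h.cyE cZ (side_star_x h.cM h.xM) cQ
      ?_ ?_ ?_ ?_ ?_ ?_ ?_ ?_ ?_ ?_ ?_ ?_ ?_ ?_ ?_
      aZD.symm aX aQ aZp.symm (xs_adj h.cM h.xM h.Mp)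
      (h.pq.mono subset_rfl (Set.subset_union_left.trans Set.subset_union_left))
      (aZy.symm.mono Set.subset_union_left subset_rfl)
      (h.xyE.symm.mono subset_rfl Set.subset_union_left)
      ((x_adj h.cN h.yN h.Nq).mono Set.subset_union_left (by
        intro u hu; simp only [Set.mem_union] at *; tauto))
    all_goals
      apply dj
      intro u h1 h2
      have := pt u
      have := @s2 u
      have := @hD u
      simp only [Set.mem_union, Set.mem_singleton_iff, Set.mem_sdiff] at *
      grind
  · obtain ⟨d', hd', m, hm, hdm⟩ := aM
    have hD' := hD hd'
    have hm' : m ∈ side G M x q := by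
      rcases h.nM m hm d' hD'.1.1 hdm.symm with h1 | h1 | h1
      · exact absurd ⟨d', hd', m, Or.inl h1, hdm⟩ aX
      · exact absurd ⟨d', hd', m, Or.inr h1, hdm⟩ aX
      · exact h1
    exact h.hex hG hm' hn (cZ.union cD (Or.inr aZD)) hD
      ⟨m, mem_comp hm'.1, d', Or.inr hd', hdm.symm⟩

theorem Cfg.caseD (hG : IsPlanar G) (h : Cfg G C p q M N x y E) {D : Set V} (cD : Cn G D)
    (hD : D ⊆ ((C \ M) \ N) \ E) (hDcl : ∀ d ∈ D, ∀ w ∈ ((C \ M) \ N) \ E, G.Adj d w → w ∈ D)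
    (aP : Ad G D (p ∪ side G M x p ∪ side G N y p))
    (aQ : Ad G D (q ∪ side G M x q ∪ side G N y q)) : False := by
  have pt := h.pt
  have dj : ∀ A B : Set V, (∀ u, u ∈ A → u ∈ B → False) → Disjoint A B :=
    fun A B hh => Set.disjoint_left.2 hh
  have cQ : Cn G (q ∪ side G M x q ∪ side G N y q) :=
    side_star _ (side_star q h.cq subset_rfl) Set.subset_union_left
  have cP : Cn G (p ∪ side G M x p ∪ side G N y p) :=
    side_star _ (side_star p h.cp subset_rfl) Set.subset_union_left
  have xP : Ad G {x} (p ∪ side G M x p ∪ side G N y p) :=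
    (x_adj h.cM h.xM h.Mp).mono subset_rfl Set.subset_union_left
  have xQ : Ad G {x} (q ∪ side G M x q ∪ side G N y q) :=
    (x_adj h.cM h.xM h.Mq).mono subset_rfl Set.subset_union_left
  have yP : Ad G {y} (p ∪ side G M x p ∪ side G N y p) :=
    (x_adj h.cN h.yN h.Np).mono subset_rfl (by
        intro u hu; simp only [Set.mem_union] at *; tauto)
  have yQ : Ad G {y} (q ∪ side G M x q ∪ side G N y q) :=
    (x_adj h.cN h.yN h.Nq).mono subset_rfl (by
        intro u hu; simp only [Set.mem_union] at *; tauto)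
  by_cases aE : Ad G D E
  · have hEn : E ≠ ∅ := by
      rintro rfl
      obtain ⟨_, _, v, hv, _⟩ := aE
      exact hv
    obtain ⟨cE, xE, yE⟩ := h.hE.resolve_left (fun hh => hEn hh.1)
    refine no_k33 hG (a := (p ∪ side G M x p ∪ side G N y p))
      (b := (q ∪ side G M x q ∪ side G N y q)) (c := E) (d := {x}) (e := {y}) (f := D)
      cP cQ cE (Cn.singleton x) (Cn.singleton y) cD
      ?_ ?_ ?_ ?_ ?_ ?_ ?_ ?_ ?_ ?_ ?_ ?_ ?_ ?_ ?_
      xP.symm yP.symm aP.symm xQ.symm yQ.symm aQ.symm xE.symm yE aE.symm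
    all_goals
      apply dj
      intro u h1 h2
      have := pt u
      have := @hD u
      simp only [Set.mem_union, Set.mem_singleton_iff, Set.mem_sdiff] at *
      grind
  have aN : Ad G D N := by
    obtain ⟨u, hu, huD, v, hv, hvD, huv⟩ := h.cCM.exit (X := D)
      (by obtain ⟨d, hd⟩ := cD.1; exact ⟨d, (hD hd).1.1, hd⟩)
      (fun hh => by
        have := hh (show y ∈ C \ M from ⟨h.NC h.yN, fun hy => Set.disjoint_left.1 h.dMN hy h.yN⟩)
        exact (hD this).1.2 h.yN)
    refine ⟨u, huD, v, ?_, huv⟩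
    by_contra hvN
    exact hvD (hDcl u huD v ⟨⟨hv, hvN⟩, fun hE => aE ⟨u, huD, v, hE, huv⟩⟩ huv)
  have aM : Ad G D M := by
    obtain ⟨u, hu, huD, v, hv, hvD, huv⟩ := h.cCN.exit (X := D)
      (by obtain ⟨d, hd⟩ := cD.1; exact ⟨d, ⟨(hD hd).1.1.1, (hD hd).1.2⟩, hd⟩)
      (fun hh => by
        have := hh (show x ∈ C \ N from ⟨h.MC h.xM, fun hy => Set.disjoint_left.1 h.dMN h.xM hy⟩)
        exact (hD this).1.1.2 h.xM)
    refine ⟨u, huD, v, ?_, huv⟩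
    by_contra hvN
    exact hvD (hDcl u huD v ⟨⟨⟨hv.1, hvN⟩, hv.2⟩, fun hE => aE ⟨u, huD, v, hE, huv⟩⟩ huv)
  have sub : ∀ a b c : Set V, a ∪ b ∪ c ⊆ a ∪ c ∪ b := by
    intro a b c u hu; simp only [Set.mem_union] at *; tauto
  have hD' : D ⊆ ((C \ N) \ M) \ E := fun u hu => by
    have := hD hu; simp only [Set.mem_sdiff] at *; tauto
  by_cases ay : Ad G D {y}
  · by_cases ax : Ad G D {x}
    · refine no_k5 hG (a := (p ∪ side G M x p ∪ side G N y p))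
        (b := (q ∪ side G M x q ∪ side G N y q)) (c := {x}) (d := {y} ∪ E) (e := D)
        cP cQ (Cn.singleton x) h.cyE cD ?_ ?_ ?_ ?_ ?_ ?_ ?_ ?_ ?_ ?_
        (h.pq.mono (Set.subset_union_left.trans Set.subset_union_left)
          (Set.subset_union_left.trans Set.subset_union_left)) xP.symm
        (yP.symm.mono subset_rfl Set.subset_union_left) aP.symm xQ.symm
        (yQ.symm.mono subset_rfl Set.subset_union_left) aQ.symm h.xyE ax.symm
        (ay.symm.mono Set.subset_union_left subset_rfl)
      all_goals
        apply dj
        intro u h1 h2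
        have := pt u
        have := @hD u
        simp only [Set.mem_union, Set.mem_singleton_iff, Set.mem_sdiff] at *
        grind
    · obtain ⟨d, hd, m, hm, hdm⟩ := aM
      rcases h.nM m hm d (hD hd).1.1 hdm.symm with h1 | h1 | h1
      · exact ax ⟨d, hd, m, h1, hdm⟩
      · exact h.swapMN.case2 hG cD hD' (aQ.mono subset_rfl (sub _ _ _)) aN ⟨d, hd, m, h1, hdm⟩
      · exact h.swapMN.swapPQ.case2 hG cD hD' (aP.mono subset_rfl (sub _ _ _)) aN
          ⟨d, hd, m, h1, hdm⟩
  · have aN' := aN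
    obtain ⟨d, hd, m, hm, hdm⟩ := aN
    rcases h.nN m hm d ⟨(hD hd).1.1.1, (hD hd).1.2⟩ hdm.symm with h1 | h1 | h1
    · exact ay ⟨d, hd, m, h1, hdm⟩
    · exact h.case2 hG cD hD aQ aM ⟨d, hd, m, h1, hdm⟩
    · exact h.swapPQ.case2 hG cD hD aP aM ⟨d, hd, m, h1, hdm⟩

theorem Cfg.hexEdge (hG : IsPlanar G) (h : Cfg G C p q M N x y E)
    (ha : Ad G (side G M x q) (side G N y p)) : False := by
  obtain ⟨m, hm, n, hn, hmn⟩ := ha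
  refine h.hex hG (D := ∅) hm hn ?_ (Set.empty_subset _) ?_
  · rw [Set.union_empty]; exact comp_cn hn.1
  · rw [Set.union_empty]; exact ⟨m, mem_comp hm.1, n, mem_comp hn.1, hmn⟩

theorem Cfg.noS (hG : IsPlanar G) (h : Cfg G C p q M N x y E) {S : Set V} (cS : Cn G S)
    (hSC : S ⊆ C) (hxS : x ∉ S) (hyS : y ∉ S) (hES : Disjoint E S)
    (hSp : Ad G S p) (hSq : Ad G S q) : False := by
  have noD : ∀ s ∈ ((C \ M) \ N) \ E,
      Ad G (comp G (((C \ M) \ N) \ E) s) (p ∪ side G M x p ∪ side G N y p) →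
      Ad G (comp G (((C \ M) \ N) \ E) s) (q ∪ side G M x q ∪ side G N y q) → False :=
    fun s hs a b => h.caseD hG (comp_cn hs) comp_sub (fun d hd w hw hdw => comp_closed hd hw hdw)
      a b
  have hE := h.swapPQ.hexEdge hG
  have hE' := h.hexEdge hG
  set T := ((C \ M) \ N) \ E with hT
  have hST : ∀ s ∈ S, s ∉ M → s ∉ N → s ∈ T := fun s hs h1 h2 =>
    ⟨⟨⟨hSC hs, h1⟩, h2⟩, fun hh => Set.disjoint_left.1 hES hh hs⟩
  have hTs : ∀ s ∈ T, s ∈ C ∧ s ∉ M ∧ s ∉ N := fun s hs => ⟨hs.1.1.1, hs.1.1.2, hs.1.2⟩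
  let X : Set V := side G M x p ∪ side G N y p ∪
    {s | s ∈ T ∧ Ad G (comp G T s) (p ∪ side G M x p ∪ side G N y p)}
  obtain ⟨a, haS, a', ha', haa⟩ := hSp
  obtain ⟨b, hbS, b', hb', hbb⟩ := hSq
  have haX : a ∈ X := by
    by_cases h1 : a ∈ M
    · have : a ∈ M \ {x} := ⟨h1, fun hh => hxS (hh ▸ haS)⟩
      exact Or.inl (Or.inl ⟨this, a, mem_comp this, a', ha', haa⟩)
    by_cases h2 : a ∈ N
    · have : a ∈ N \ {y} := ⟨h2, fun hh => hyS (hh ▸ haS)⟩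
      exact Or.inl (Or.inr ⟨this, a, mem_comp this, a', ha', haa⟩)
    have := hST a haS h1 h2
    exact Or.inr ⟨this, a, mem_comp this, a', Or.inl (Or.inl ha'), haa⟩
  have hbX : b ∉ X := by
    intro hbX
    by_cases h1 : b ∈ M
    · have : b ∈ M \ {x} := ⟨h1, fun hh => hxS (hh ▸ hbS)⟩
      have hh : b ∈ side G M x q := ⟨this, b, mem_comp this, b', hb', hbb⟩
      rcases hbX with (h3 | h3) | h3
      · exact Set.disjoint_left.1 h.sM h3 hh
      · exact Set.disjoint_left.1 h.dMN h1 (side_sub h3).1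
      · exact (hTs b h3.1).2.1 h1
    by_cases h2 : b ∈ N
    · have : b ∈ N \ {y} := ⟨h2, fun hh => hyS (hh ▸ hbS)⟩
      have hh : b ∈ side G N y q := ⟨this, b, mem_comp this, b', hb', hbb⟩
      rcases hbX with (h3 | h3) | h3
      · exact h1 (side_sub h3).1
      · exact Set.disjoint_left.1 h.sN h3 hh
      · exact (hTs b h3.1).2.2 h2
    rcases hbX with (h3 | h3) | h3
    · exact h1 (side_sub h3).1
    · exact h2 (side_sub h3).1
    · exact noD b h3.1 h3.2 ⟨b, mem_comp h3.1, b', Or.inl (Or.inl hb'), hbb⟩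
  obtain ⟨u, huS, huX, w, hwS, hwX, huw⟩ := cS.exit ⟨a, haS, haX⟩ (fun hh => hbX (hh hbS))
  have hwx : w ≠ x := fun hh => hxS (hh ▸ hwS)
  have hwy : w ≠ y := fun hh => hyS (hh ▸ hwS)
  rcases huX with (h3 | h3) | h3
  · by_cases h1 : w ∈ M
    · exact hwX (Or.inl (Or.inl (comp_side h3 (comp_closed (mem_comp h3.1) ⟨h1, hwx⟩ huw))))
    by_cases h2 : w ∈ N
    · rcases h.nN w h2 u ⟨h.MC (side_sub h3).1, fun hh => Set.disjoint_left.1 h.dMN (side_sub h3).1 hh⟩ huw.symm with h4 | h4 | h4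
      · exact hwy h4
      · exact hwX (Or.inl (Or.inr h4))
      · exact hE ⟨u, h3, w, h4, huw⟩
    have := hST w hwS h1 h2
    exact hwX (Or.inr ⟨this, w, mem_comp this, u, Or.inl (Or.inr h3), huw.symm⟩)
  · by_cases h1 : w ∈ N
    · exact hwX (Or.inl (Or.inr (comp_side h3 (comp_closed (mem_comp h3.1) ⟨h1, hwy⟩ huw))))
    by_cases h2 : w ∈ M
    · rcases h.nM w h2 u ⟨h.NC (side_sub h3).1, fun hh => Set.disjoint_left.1 h.dMN hh (side_sub h3).1⟩ huw.symm with h4 | h4 | h4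
      · exact hwx h4
      · exact hwX (Or.inl (Or.inl h4))
      · exact hE' ⟨w, h4, u, h3, huw.symm⟩
    have := hST w hwS h2 h1
    exact hwX (Or.inr ⟨this, w, mem_comp this, u, Or.inr h3, huw.symm⟩)
  · have hTu := hTs u h3.1
    by_cases h1 : w ∈ M
    · rcases h.nM w h1 u ⟨hTu.1, hTu.2.1⟩ huw.symm with h4 | h4 | h4
      · exact hwx h4
      · exact hwX (Or.inl (Or.inl h4))
      · exact noD u h3.1 h3.2 ⟨u, mem_comp h3.1, w, Or.inl (Or.inr h4), huw⟩
    by_cases h2 : w ∈ N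
    · rcases h.nN w h2 u ⟨hTu.1, hTu.2.2⟩ huw.symm with h4 | h4 | h4
      · exact hwy h4
      · exact hwX (Or.inl (Or.inr h4))
      · exact noD u h3.1 h3.2 ⟨u, mem_comp h3.1, w, Or.inr h4, huw⟩
    have hwT := hST w hwS h1 h2
    have := comp_closed (mem_comp h3.1) hwT huw
    exact hwX (Or.inr ⟨hwT, by rw [comp_eq this]; exact h3.2⟩)

theorem link {R : Set V} (hR : Cn G R) (h1 : (R ∩ M).Nonempty) (h2 : (R ∩ N).Nonempty)
    (hd : Disjoint M N) : ∃ x ∈ R ∩ M, ∃ y ∈ R ∩ N, ∃ E ⊆ (R \ M) \ N,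
      (E = ∅ ∧ G.Adj x y) ∨ (Cn G E ∧ Ad G {x} E ∧ Ad G E {y}) := by
  let T := (R \ M) \ N
  let X : Set V := M ∪ {s | s ∈ T ∧ Ad G (comp G T s) (R ∩ M)}
  obtain ⟨n, hn⟩ := h2
  obtain ⟨m, hm⟩ := h1
  obtain ⟨u, huR, huX, w, hwR, hwX, huw⟩ := hR.exit (X := X) ⟨m, hm.1, Or.inl hm.2⟩ (fun hh => by
    rcases hh hn.1 with h3 | h3
    · exact Set.disjoint_left.1 hd h3 hn.2
    · exact h3.1.2 hn.2)
  have hwM : w ∉ M := fun hh => hwX (Or.inl hh)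
  rcases huX with h3 | ⟨h3, h4⟩
  · by_cases h5 : w ∈ N
    · exact ⟨u, ⟨huR, h3⟩, w, ⟨hwR, h5⟩, ∅, Set.empty_subset _, Or.inl ⟨rfl, huw⟩⟩
    · have hwT : w ∈ T := ⟨⟨hwR, hwM⟩, h5⟩
      exact absurd (Or.inr ⟨hwT, w, mem_comp hwT, u, ⟨huR, h3⟩, huw.symm⟩) hwX
  · by_cases h5 : w ∈ N
    · obtain ⟨e, he, x, hx, hex⟩ := h4
      exact ⟨x, hx, w, ⟨hwR, h5⟩, comp G T u, comp_sub, Or.inr ⟨comp_cn h3,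
        ⟨x, rfl, e, he, hex.symm⟩, ⟨u, mem_comp h3, w, rfl, huw⟩⟩⟩
    · have hwT : w ∈ T := ⟨⟨hwR, hwM⟩, h5⟩
      have := comp_closed (mem_comp h3) hwT huw
      exact absurd (Or.inr ⟨hwT, by rw [comp_eq this]; exact h4⟩) hwX

theorem topmost (hC : Cn G C) (hM : Minimal (Fam G C p q) M) (hK : (C \ M).Nonempty)
    (hKp : ¬ Ad G (C \ M) p) :
    ∃ x ∈ C, ∀ S ⊆ C, Cn G S → x ∉ S → Ad G S p → Ad G S q → False := by
  classical
  have hMC := hM.1.1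
  have hMc := hM.1.2.1
  have hMq := hM.1.2.2.2.2
  let Bd : Set V := {m | m ∈ M ∧ ∃ k ∈ C \ M, G.Adj m k}
  have hBd : Bd.Nonempty := by
    obtain ⟨k, hk⟩ := hK
    obtain ⟨m, hm⟩ := hMc.1
    obtain ⟨u, huC, huM, w, hwC, hwM, huw⟩ := hC.exit (X := M) ⟨m, hMC hm, hm⟩
      (fun hh => hk.2 (hh hk.1))
    exact ⟨u, huM, w, ⟨hwC, hwM⟩, huw⟩
  obtain ⟨x, hx, hmin⟩ := Set.exists_min_image Bd (fun x => (side G M x p).ncard)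
    (Set.toFinite _) hBd
  obtain ⟨hxM, k, hk, hxk⟩ := hx
  refine ⟨x, hMC hxM, fun S hSC cS hxS hSp hSq => ?_⟩
  obtain ⟨a, haS, a', ha', haa⟩ := hSp
  obtain ⟨b, hbS, b', hb', hbb⟩ := hSq
  have haM : a ∈ M := by
    by_contra haM
    exact hKp ⟨a, ⟨hSC haS, haM⟩, a', ha', haa⟩
  have haMx : a ∈ M \ {x} := ⟨haM, fun hh => hxS (hh ▸ haS)⟩
  have hZp : Ad G (comp G (M \ {x}) a) p := ⟨a, mem_comp haMx, a', ha', haa⟩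
  have hZq : ¬ Ad G (comp G (M \ {x}) a) q := fun hh => min_sep hM hxM hk hxk haMx hZp hh
  obtain ⟨x', hx'S, hx'Z, w, hwS, hwZ, hxw⟩ := cS.exit (X := comp G (M \ {x}) a)
    ⟨a, haS, mem_comp haMx⟩ (fun hh => hZq ⟨b, hh hbS, b', hb', hbb⟩)
  have hx'M := comp_sub hx'Z
  have hwM : w ∉ M := fun hh =>
    hwZ (comp_closed hx'Z ⟨hh, fun hh => hxS (hh ▸ hwS)⟩ hxw)
  have hx'B : x' ∈ Bd := ⟨hx'M.1, w, ⟨hSC hwS, hwM⟩, hxw⟩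
  have hx's : x' ∈ side G M x p := ⟨hx'M, by rw [comp_eq hx'Z]; exact hZp⟩
  have hsub : side G M x' p ⊆ side G M x p := by
    intro m hm
    have hxZ : x ∉ comp G (M \ {x'}) m := by
      intro hxZ
      have h1 := side_star_x (p := q) hMc hxM
      have h2 := xs_adj hMc hxM hMq
      have h3 : {x} ∪ side G M x q ⊆ M \ {x'} := by
        rintro u (hu | hu)
        · have : u = x := hu
          subst this
          exact ⟨hxM, fun hh => hx'M.2 hh.symm⟩
        · refine ⟨(side_sub hu).1, fun hh => ?_⟩
          have : u = x' := hh
          subst this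
          exact min_sep hM hxM hk hxk hx'M hx's.2 hu.2
      have h4 := sub_comp h3 h1 (Or.inl rfl)
      rw [comp_eq hxZ] at h4
      exact min_sep hM hx'M.1 ⟨hSC hwS, hwM⟩ hxw hm.1 hm.2 (h2.symm.mono h4 subset_rfl)
    have hsub : comp G (M \ {x'}) m ⊆ M \ {x} := fun u hu =>
      ⟨(comp_sub hu).1, fun hh => hxZ (by have : u = x := hh; exact this ▸ hu)⟩
    have hmm := mem_comp (G := G) hm.1
    exact ⟨hsub hmm, hm.2.mono (sub_comp hsub (comp_cn hm.1) hmm) subset_rfl⟩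
  have hlt := Set.ncard_lt_ncard (LE.le.ssubset_of_mem_notMem hsub hx's
    (fun hh => (side_sub hh).2 rfl)) (Set.toFinite _)
  exact absurd (hmin x' hx'B) (not_le.2 hlt)

theorem pairLemma (hG : IsPlanar G) (cC : Cn G C) (cp : Cn G p) (cq : Cn G q)
    (hpq : Ad G p q) (dpq : Disjoint p q) (dpC : Disjoint p C) (dqC : Disjoint q C)
    (aCp : Ad G C p) (aCq : Ad G C q) :
    ∃ x ∈ C, ∃ y ∈ C, ∀ R ⊆ C, Cn G R → x ∈ R → y ∈ R → ∀ S ⊆ C, Cn G S → Disjoint R S →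
      Ad G S p → Ad G S q → False := by
  obtain ⟨M, -, hM⟩ := exists_minimal_le_of_wellFoundedLT (Fam G C p q) C
    ⟨subset_rfl, cC, Or.inl (by simp), aCp, aCq⟩
  rcases hM.1.2.2.1 with hK | hK
  · have hMC : M = C := by
      apply Set.Subset.antisymm hM.1.1
      rwa [Set.sdiff_eq_empty] at hK
    subst hMC
    obtain ⟨x, hx⟩ := cC.1
    refine ⟨x, hx, x, hx, fun R hRC cR hxR _ S hSC cS hRS hSp hSq => ?_⟩
    have hxS : x ∉ S := fun hh => Set.disjoint_left.1 hRS hxR hh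
    obtain ⟨s, hs⟩ := cS.1
    have hSx : S ⊆ M \ {x} := fun u hu => ⟨hSC hu, fun hh => hxS (by
      have : u = x := hh
      exact this ▸ hu)⟩
    have hSZ := sub_comp hSx cS hs
    have hZM : comp G (M \ {x}) s ⊆ M := comp_sub.trans Set.sdiff_subset
    have hxZ : x ∉ comp G (M \ {x}) s := fun h => (comp_sub h).2 rfl
    have e1 : Cn G (M \ comp G (M \ {x}) s) := by
      have h := star_rest cC hx (Cn.singleton x) rfl (comp G (M \ {x}) s)
        (fun m' _ h => comp_disj h)
      convert h using 1
      ext u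
      by_cases hux : u = x
      · subst hux; simp_all
      · simp only [Set.mem_sdiff, Set.mem_union, Set.mem_singleton_iff]; tauto
    exact hxZ (hM.2 ⟨hZM, comp_cn (hSx hs), Or.inr e1, hSp.mono hSZ subset_rfl,
      hSq.mono hSZ subset_rfl⟩ hZM hx)
  by_cases hKp : Ad G (C \ M) p
  swap
  · obtain ⟨x, hx, h⟩ := topmost cC hM hK.1 hKp
    exact ⟨x, hx, x, hx, fun R _ _ hxR _ S hSC cS hRS =>
      h S hSC cS (fun hh => Set.disjoint_left.1 hRS hxR hh)⟩
  by_cases hKq : Ad G (C \ M) q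
  swap
  · obtain ⟨x, hx, h⟩ := topmost cC (min_swap hM) hK.1 hKq
    exact ⟨x, hx, x, hx, fun R _ _ hxR _ S hSC cS hRS h1 h2 =>
      h S hSC cS (fun hh => Set.disjoint_left.1 hRS hxR hh) h2 h1⟩
  have hMC := hM.1.1
  obtain ⟨N, hNK, hN⟩ := exists_minimal_le_of_wellFoundedLT (Fam G C p q) (C \ M)
    ⟨Set.sdiff_subset, hK, Or.inr (by rw [Set.sdiff_sdiff_cancel_left hMC]; exact hM.1.2.1), hKp, hKq⟩
  obtain ⟨x, hx⟩ := hM.1.2.1.1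
  obtain ⟨y, hy⟩ := hN.1.2.1.1
  have hdMN : Disjoint M N := Set.disjoint_left.2 fun u hu hu' => (hNK hu').2 hu
  refine ⟨x, hMC hx, y, hN.1.1 hy, fun R hRC cR hxR hyR S hSC cS hRS hSp hSq => ?_⟩
  obtain ⟨x', hx', y', hy', E, hE, hE'⟩ := link cR ⟨x, hxR, hx⟩ ⟨y, hyR, hy⟩ hdMN
  have kx : ∃ k ∈ C \ M, G.Adj x' k := by
    rcases hE' with ⟨_, h⟩ | ⟨_, h, _⟩
    · exact ⟨y', hNK hy'.2, h⟩
    · obtain ⟨u, hu, v, hv, huv⟩ := h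
      have : u = x' := hu
      subst this
      exact ⟨v, ⟨hRC (hE hv).1.1, (hE hv).1.2⟩, huv⟩
  have ky : ∃ k ∈ C \ N, G.Adj y' k := by
    rcases hE' with ⟨_, h⟩ | ⟨_, _, h⟩
    · exact ⟨x', ⟨hMC hx'.2, fun hh => Set.disjoint_left.1 hdMN hx'.2 hh⟩, h.symm⟩
    · obtain ⟨v, hv, u, hu, huv⟩ := h
      have : u = y' := hu
      subst this
      exact ⟨v, ⟨hRC (hE hv).1.1, (hE hv).2⟩, huv.symm⟩
  obtain ⟨k, hk, hxk⟩ := kx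
  obtain ⟨l, hl, hyl⟩ := ky
  have hNne : C \ N ≠ ∅ := fun hh => by rw [hh] at hl; exact hl
  have cfg : Cfg G C p q M N x' y' E :=
    { cp := cp, cq := cq, pq := hpq, dpq := dpq, dpC := dpC, dqC := dqC, MC := hMC, NC := hN.1.1
      dMN := hdMN, cM := hM.1.2.1, cN := hN.1.2.1, Mp := hM.1.2.2.2.1, Mq := hM.1.2.2.2.2
      Np := hN.1.2.2.2.1, Nq := hN.1.2.2.2.2, cCM := hK
      cCN := hN.1.2.2.1.resolve_left hNne
      xM := hx'.2, yN := hy'.2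
      sM := Set.disjoint_left.2 fun u h1 h2 => min_sep hM hx'.2 hk hxk h1.1 h1.2 h2.2
      sN := Set.disjoint_left.2 fun u h1 h2 => min_sep hN hy'.2 hl hyl h1.1 h1.2 h2.2
      nM := fun m hm k hk ha => min_nb hM hx'.2 hm hk ha
      nN := fun m hm k hk ha => min_nb hN hy'.2 hm hk ha
      EC := fun u hu => ⟨⟨hRC (hE hu).1.1, (hE hu).1.2⟩, (hE hu).2⟩
      hE := hE' }
  exact cfg.noS hG cS hSC (fun hh => Set.disjoint_left.1 hRS hx'.1 hh)
    (fun hh => Set.disjoint_left.1 hRS hy'.1 hh)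
    (Set.disjoint_left.2 fun u hu hh => Set.disjoint_left.1 hRS (hE hu).1.1 hh) hSp hSq

def WIn (G : SimpleGraph V) (S : Set V) (n : ℕ) (u v : V) : Prop :=
  ∃ p : G.Walk u v, p.length ≤ n ∧ ∀ w ∈ p.support, w ∈ S

def FF (s t : ℕ) : ℕ := min s t + (max s t + 1).choose 2

def Bud (G : SimpleGraph V) (r : ℕ) (C : Set V) (v : V) (X : Set V) (s : ℕ) : Prop :=
  s = 0 ∨ ∃ n a x, n + s ≤ r ∧ WIn G C n v a ∧ x ∈ X ∧ G.Adj a x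

def WW (G : SimpleGraph V) (r : ℕ) (C : Set V) (ρ : V → ℕ) (v : V) : Set V :=
  {u | ∃ p : G.Walk v u, p.length ≤ r ∧ ∀ w ∈ p.support, w ∈ C ∧ ρ u ≤ ρ w}

def Concl (G : SimpleGraph V) (r : ℕ) (C P Q : Set V) (ρ : V → ℕ) : Prop :=
  ∀ v ∈ C, ∀ s t, Bud G r C v P s → Bud G r C v Q t →
    (WW G r C ρ v).ncard + (2 * r + 1) * FF s t ≤ (2 * r + 1) * (r + 2).choose 2

theorem FF_comm (s t : ℕ) : FF s t = FF t s := by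
  unfold FF; rw [min_comm, max_comm]

theorem FF_mono {s t s' t' : ℕ} (h : s ≤ s') (h' : t ≤ t') : FF s t ≤ FF s' t' := by
  unfold FF
  have := Nat.choose_le_choose 2 (show max s t + 1 ≤ max s' t' + 1 by omega)
  omega

theorem FF_diag (b : ℕ) : 1 + FF b b = (b + 2).choose 2 := by
  unfold FF
  have h : (b + 2).choose 2 = (b + 1) + (b + 1).choose 2 := by
    rw [Nat.choose_succ_succ' (b + 1) 1, Nat.choose_one_right]
  rw [min_self, max_self, h]
  omega

theorem FF_zero (b : ℕ) (s : ℕ) : (b + 1).choose 2 ≤ FF b s := by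
  unfold FF
  have := Nat.choose_le_choose 2 (show b + 1 ≤ max b s + 1 by omega)
  omega

theorem FF_step1 {b s t : ℕ} (ht : t + 1 ≤ b) : 1 + FF s t ≤ FF b s := by
  rcases le_or_gt b s with h | h
  · unfold FF
    rw [max_eq_left (by omega : t ≤ s), max_eq_right h]
    omega
  · obtain ⟨c, rfl⟩ : ∃ c, b = c + 1 := ⟨b - 1, by omega⟩
    have h1 := FF_mono (show s ≤ c by omega) (show t ≤ c by omega)
    have h2 := FF_diag c
    have h3 : (c + 2).choose 2 ≤ FF (c + 1) s := FF_zero (c + 1) s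
    omega

theorem FF_step2 {b s t : ℕ} (hs : s + 1 ≤ b) (ht : t + 1 ≤ b) : 1 + FF s t ≤ FF b 0 := by
  obtain ⟨c, rfl⟩ : ∃ c, b = c + 1 := ⟨b - 1, by omega⟩
  have h1 := FF_mono (show s ≤ c by omega) (show t ≤ c by omega)
  have h2 := FF_diag c
  have h3 : (c + 2).choose 2 ≤ FF (c + 1) 0 := FF_zero (c + 1) 0
  omega

theorem Concl.symm {r : ℕ} {P Q : Set V} {ρ : V → ℕ} (h : Concl G r C P Q ρ) :
    Concl G r C Q P ρ := by
  intro v hv s t hs ht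
  rw [FF_comm]
  exact h v hv t s ht hs

theorem Concl.mono {r : ℕ} {P Q Q' : Set V} {ρ : V → ℕ} (h : Concl G r C P Q ρ)
    (hQ : Q' ⊆ Q) : Concl G r C P Q' ρ := by
  intro v hv s t hs ht
  refine h v hv s t hs (ht.imp id ?_)
  rintro ⟨n, a, x, h1, h2, h3, h4⟩
  exact ⟨n, a, x, h1, h2, hQ h3, h4⟩

theorem WIn.right {S : Set V} {n : ℕ} {u v : V} (h : WIn G S n u v) : v ∈ S := by
  obtain ⟨p, _, h⟩ := h
  exact h v p.end_mem_support

theorem Concl.ofNot {r : ℕ} {P Q : Set V} {ρ : V → ℕ} (h : Concl G r C P ∅ ρ)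
    (hQ : ¬ Ad G C Q) : Concl G r C P Q ρ := by
  intro v hv s t hs ht
  refine h v hv s t hs (ht.imp id ?_)
  rintro ⟨n, a, x, h1, h2, h3, h4⟩
  exact absurd ⟨a, h2.right, x, h3, h4⟩ hQ

theorem exitWalk {D R : Set V} (hcl : ∀ u ∈ D, ∀ w ∈ C, G.Adj u w → w ∈ D ∨ w ∈ R)
    {v z : V} (p : G.Walk v z) (hv : v ∈ D) (hp : ∀ w ∈ p.support, w ∈ C) :
    (∀ w ∈ p.support, w ∈ D) ∨
      ∃ n a x, n + 1 ≤ p.length ∧ WIn G D n v a ∧ x ∈ R ∧ x ∈ p.support ∧ G.Adj a x := by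
  induction p with
  | nil => left; intro w hw; simp at hw; exact hw ▸ hv
  | @cons u w z h p ih =>
    have hw : w ∈ p.support := p.start_mem_support
    have hwC : w ∈ C := hp w (by simp)
    rcases hcl u hv w hwC h with hwD | hwR
    · rcases ih hwD (fun w' hw' => hp w' (by simp [hw'])) with h1 | ⟨n, a, x, h1, ⟨q, hq, hq'⟩, h3, h4, h5⟩
      · left
        intro w' hw'
        rw [Walk.support_cons, List.mem_cons] at hw'
        rcases hw' with rfl | hw'
        · exact hv
        · exact h1 w' hw'
      · right
        refine ⟨n + 1, a, x, by simpa using h1, ⟨Walk.cons h q, by simpa using hq, ?_⟩, h3,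
          by simp [h4], h5⟩
        intro w' hw'
        rw [Walk.support_cons, List.mem_cons] at hw'
        rcases hw' with rfl | hw'
        · exact hv
        · exact hq' w' hw'
    · right
      exact ⟨0, u, w, by simp, ⟨Walk.nil, by simp, by simpa using hv⟩, hwR, by simp, h⟩

theorem step {r : ℕ} {P Q R : Set V} (hRC : R ⊆ C)
    (hR : ∀ v, {u | u ∈ R ∧ WIn G C r v u}.ncard ≤ 2 * r + 1)
    (hD : ∀ d ∈ C \ R, ∃ ρ,
      (¬ Ad G (comp G (C \ R) d) Q ∧ Concl G r (comp G (C \ R) d) (C \ comp G (C \ R) d) P ρ) ∨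
      (¬ Ad G (comp G (C \ R) d) P ∧ Concl G r (comp G (C \ R) d) (C \ comp G (C \ R) d) Q ρ)) :
    ∃ ρ, Concl G r C P Q ρ := by
  classical
  have hD' : ∀ D : Set V, ∃ ρ : V → ℕ, (∃ d ∈ C \ R, D = comp G (C \ R) d) →
      (¬ Ad G D Q ∧ Concl G r D (C \ D) P ρ) ∨ (¬ Ad G D P ∧ Concl G r D (C \ D) Q ρ) := by
    intro D
    by_cases h : ∃ d ∈ C \ R, D = comp G (C \ R) d
    · obtain ⟨d, hd, rfl⟩ := h
      obtain ⟨ρ, hρ⟩ := hD d hd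
      exact ⟨ρ, fun _ => hρ⟩
    · exact ⟨fun _ => 0, fun hh => absurd hh h⟩
  choose ρD hρD using hD'
  let ρ : V → ℕ := fun v => if v ∈ R then 0 else 1 + ρD (comp G (C \ R) v) v
  have ρR : ∀ v ∈ R, ρ v = 0 := fun v hv => by simp [ρ, hv]
  have ρR' : ∀ v ∉ R, 1 ≤ ρ v := fun v hv => by simp [ρ, hv]
  refine ⟨ρ, fun v hv s t hs ht => ?_⟩
  by_cases hvR : v ∈ R
  · have h1 : WW G r C ρ v ⊆ {u | u ∈ R ∧ WIn G C r v u} := by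
      rintro u ⟨p, hp, hp'⟩
      refine ⟨?_, p, hp, fun w hw => (hp' w hw).1⟩
      by_contra huR
      have := (hp' v p.start_mem_support).2
      rw [ρR v hvR] at this
      have := ρR' u huR
      omega
    have h2 := (Set.ncard_le_ncard h1 (Set.toFinite _)).trans (hR v)
    have hs' : s ≤ r := by rcases hs with h | ⟨n, _, _, h, _⟩ <;> omega
    have ht' : t ≤ r := by rcases ht with h | ⟨n, _, _, h, _⟩ <;> omega
    have h3 := FF_mono hs' ht'
    have h4 := FF_diag r
    rw [← h4, mul_add, mul_one]
    exact add_le_add h2 (Nat.mul_le_mul_left _ h3)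
  · have hvC : v ∈ C \ R := ⟨hv, hvR⟩
    have key : ∀ P Q : Set V, ∀ s t, Bud G r C v P s → Bud G r C v Q t →
        ¬ Ad G (comp G (C \ R) v) Q →
        Concl G r (comp G (C \ R) v) (C \ comp G (C \ R) v) P (ρD (comp G (C \ R) v)) →
        (WW G r C ρ v).ncard + (2 * r + 1) * FF s t ≤ (2 * r + 1) * (r + 2).choose 2 := by
      clear hs ht s t
      intro P Q s t hs ht hDQ hc
      have hρ : ∀ w ∈ comp G (C \ R) v, ρ w = 1 + ρD (comp G (C \ R) v) w := by
        intro w hw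
        have : w ∉ R := (comp_sub hw).2
        simp only [ρ, this, if_false, comp_eq hw]
      have hvD : v ∈ comp G (C \ R) v := mem_comp hvC
      have hcl : ∀ u ∈ comp G (C \ R) v, ∀ w ∈ C, G.Adj u w → w ∈ comp G (C \ R) v ∨ w ∈ R := by
        intro u hu w hw huw
        by_cases hwR : w ∈ R
        · exact Or.inr hwR
        · exact Or.inl (comp_closed hu ⟨hw, hwR⟩ huw)
      have hDR : R ⊆ C \ comp G (C \ R) v := fun u hu => ⟨hRC hu, fun hh => (comp_sub hh).2 hu⟩
      set D := comp G (C \ R) v with hDdef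
      have hW : WW G r C ρ v ⊆ WW G r D (ρD D) v ∪ {u | u ∈ R ∧ WIn G C r v u} := by
        rintro u ⟨p, hp, hp'⟩
        by_cases huR : u ∈ R
        · exact Or.inr ⟨huR, p, hp, fun w hw => (hp' w hw).1⟩
        · left
          have h1 : ∀ w ∈ p.support, w ∈ D := by
            rcases exitWalk hcl p hvD (fun w hw => (hp' w hw).1) with h | ⟨n, a, x, _, _, h3, h4, _⟩
            · exact h
            · have := (hp' x h4).2
              rw [ρR x h3] at this
              have := ρR' u huR
              omega
          refine ⟨p, hp, fun w hw => ⟨h1 w hw, ?_⟩⟩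
          have := (hp' w hw).2
          rw [hρ w (h1 w hw), hρ u (h1 u p.end_mem_support)] at this
          omega
      have hWc := (Set.ncard_le_ncard hW (Set.toFinite _)).trans (Set.ncard_union_le _ _)
      set b := Nat.findGreatest (Bud G r D v R) r with hb
      have hbB : Bud G r D v R b := Nat.findGreatest_spec (m := 0) (Nat.zero_le _) (Or.inl rfl)
      have hbm : ∀ c, Bud G r D v R c → c ≤ b := by
        intro c hc
        have : c ≤ r := by rcases hc with h | ⟨n, _, _, h, _⟩ <;> omega
        exact Nat.le_findGreatest this hc
      have hbB' : Bud G r D v (C \ D) b := by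
        refine hbB.imp id ?_
        rintro ⟨n, a, x, h1, h2, h3, h4⟩
        exact ⟨n, a, x, h1, h2, hDR h3, h4⟩
      have hout : ∀ X s, Bud G r C v X s → (s + 1 ≤ b) ∨ Bud G r D v X s := by
        rintro X s (h | ⟨n, a, x, h1, ⟨p, hp, hp'⟩, h3, h4⟩)
        · exact Or.inr (Or.inl h)
        · rcases exitWalk hcl p hvD hp' with h | ⟨n', a', x', h5, h6, h7, _, h8⟩
          · exact Or.inr (Or.inr ⟨n, a, x, h1, ⟨p, hp, h⟩, h3, h4⟩)
          · exact Or.inl (hbm _ (Or.inr ⟨n', a', x', by omega, h6, h7, h8⟩))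
      have htb : t = 0 ∨ t + 1 ≤ b := by
        rcases hout Q t ht with h | h | ⟨n, a, x, h1, h2, h3, h4⟩
        · exact Or.inr h
        · exact Or.inl h
        · exact absurd ⟨a, h2.right, x, h3, h4⟩ hDQ
      by_cases hb0 : b = 0
      · have hemp : {u | u ∈ R ∧ WIn G C r v u} = ∅ := by
          rw [Set.eq_empty_iff_forall_notMem]
          rintro u ⟨huR, p, hp, hp'⟩
          rcases exitWalk hcl p hvD hp' with h | ⟨n', a', x', h5, h6, h7, _, h8⟩
          · exact (hDR huR).2 (h u p.end_mem_support)
          · have := hbm 1 (Or.inr ⟨n', a', x', by omega, h6, h7, h8⟩)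
            omega
        rw [hemp, Set.ncard_empty] at hWc
        have hsD : Bud G r D v P s := (hout P s hs).resolve_left (by omega)
        have ht0 : t = 0 := by omega
        have := hc v hvD b s hbB' hsD
        rw [hb0, FF_comm, ← ht0] at this
        omega
      · have h2 := hR v
        have : ∃ s', Bud G r D v P s' ∧ 1 + FF s t ≤ FF b s' := by
          rcases hout P s hs with h | h
          · exact ⟨0, Or.inl rfl, FF_step2 h (by omega)⟩
          · exact ⟨s, h, FF_step1 (by omega)⟩
        obtain ⟨s', hs', hF⟩ := this
        have h3 := hc v hvD b s' hbB' hs'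
        have h4 := Nat.mul_le_mul_left (2 * r + 1) hF
        rw [mul_add, mul_one] at h4
        omega
    rcases hρD _ ⟨v, hvC, rfl⟩ with ⟨h1, h2⟩ | ⟨h1, h2⟩
    · exact key P Q s t hs ht h1 h2
    · rw [FF_comm]
      exact key Q P t s ht hs h1 h2

theorem support_cn {u v : V} (p : G.Walk u v) : Cn G {w | w ∈ p.support} := by
  induction p with
  | nil => simpa using Cn.singleton _
  | @cons u w z h p ih =>
    have := (Cn.singleton (G := G) u).union ih (Or.inr ⟨u, rfl, w, p.start_mem_support, h⟩)
    convert this using 1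
    ext a
    simp

theorem Cn.walk {S : Set V} (h : Cn G S) {x y : V} (hx : x ∈ S) (hy : y ∈ S) :
    ∃ n, WIn G S n x y := by
  have := h.2 {z | z ∈ S ∧ ∃ n, WIn G S n x z} (fun z hz => hz.1)
    ⟨x, hx, 0, Walk.nil, by simp, by simpa using hx⟩ (by
      rintro u ⟨hu, n, p, hp, hp'⟩ w hw huw
      refine ⟨hw, n + 1, p.concat huw, by simpa using hp, ?_⟩
      intro a ha
      rw [Walk.support_concat] at ha
      simp at ha
      rcases ha with ha | ha
      · exact hp' a ha
      · exact ha ▸ hw)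
  exact (this hy).2

theorem geodesic (r : ℕ) (hC : Cn G C) (hx : x ∈ C) (hy : y ∈ C) :
    ∃ R ⊆ C, Cn G R ∧ x ∈ R ∧ y ∈ R ∧
      ∀ v, {u | u ∈ R ∧ WIn G C r v u}.ncard ≤ 2 * r + 1 := by
  classical
  have hex := hC.walk hx hy
  obtain ⟨p, hp, hpC⟩ := Nat.find_spec hex
  have hmin : ∀ q : G.Walk x y, (∀ w ∈ q.support, w ∈ C) → p.length ≤ q.length := fun q hq =>
    hp.trans (Nat.find_min' hex ⟨q, le_rfl, hq⟩)
  refine ⟨{w | w ∈ p.support}, hpC, support_cn p, p.start_mem_support, p.end_mem_support, ?_⟩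
  intro v
  by_cases hne : ∃ i, i ≤ p.length ∧ WIn G C r v (p.getVert i)
  · have hi := Nat.find_spec hne
    have hi' := fun j => Nat.find_min' hne (m := j)
    set i := Nat.find hne
    have hsub : {u | u ∈ {w | w ∈ p.support} ∧ WIn G C r v u} ⊆
        p.getVert '' (Finset.Icc i (i + 2 * r) : Finset ℕ) := by
      rintro u ⟨hu, huW⟩
      obtain ⟨j, rfl, hj⟩ := Walk.mem_support_iff_exists_getVert.1 hu
      refine ⟨j, ?_, rfl⟩
      have hij := hi' j ⟨hj, huW⟩
      simp only [Finset.coe_Icc, Set.mem_Icc]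
      refine ⟨hij, ?_⟩
      obtain ⟨a, ha, ha'⟩ := hi.2
      obtain ⟨b, hb, hb'⟩ := huW
      have := hmin ((p.take i).append ((a.reverse.append b).append (p.drop j))) (by
        intro w hw
        simp only [Walk.mem_support_append_iff, Walk.support_reverse, List.mem_reverse] at hw
        rcases hw with hw | (hw | hw) | hw
        · exact hpC w (by rw [Walk.support_take] at hw; exact List.mem_of_mem_take hw)
        · exact ha' w hw
        · exact hb' w hw
        · exact hpC w ((p.isSubwalk_drop j).support_subset hw))
      simp only [Walk.length_append, Walk.length_reverse, Walk.take_length, Walk.drop_length] at this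
      omega
    refine (Set.ncard_le_ncard hsub (Set.toFinite _)).trans ((Set.ncard_image_le (Finset.finite_toSet _)).trans ?_)
    rw [Set.ncard_coe_finset, Nat.card_Icc]
    omega
  · have : {u | u ∈ {w | w ∈ p.support} ∧ WIn G C r v u} = ∅ := by
      rw [Set.eq_empty_iff_forall_notMem]
      rintro u ⟨hu, huW⟩
      obtain ⟨j, rfl, hj⟩ := Walk.mem_support_iff_exists_getVert.1 hu
      exact hne ⟨j, hj, huW⟩
    rw [this]; simp

theorem rest_cn {R : Set V} (hC : Cn G C) (hRC : R ⊆ C) (hR : Cn G R) {d : V} :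
    Cn G (C \ comp G (C \ R) d) := by
  have h : Cn G (R ∪ ((C \ R) \ comp G (C \ R) d)) := by
    apply hR.star
    intro s hs
    refine ⟨comp G (C \ R) s, fun u hu => ⟨comp_sub hu, fun hh =>
      Set.disjoint_left.1 (comp_disj hs.2) hu hh⟩, comp_cn hs.1, mem_comp hs.1, ?_⟩
    obtain ⟨a, ha⟩ := hR.1
    obtain ⟨u, hu, huX, w, hw, hwX, huw⟩ := hC.exit (X := comp G (C \ R) s)
      ⟨s, hs.1.1, mem_comp hs.1⟩ (fun hh => (comp_sub (hh (hRC ha))).2 ha)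
    refine ⟨u, huX, w, ?_, huw⟩
    by_contra hwR
    exact hwX (comp_closed huX ⟨hw, hwR⟩ huw)
  convert h using 1
  ext u
  have h1 := @hRC u
  have h2 : u ∈ comp G (C \ R) d → u ∈ C \ R := fun hh => comp_sub hh
  simp only [Set.mem_sdiff, Set.mem_union] at *
  tauto

theorem singleton_count (r : ℕ) (x v : V) :
    {u | u ∈ ({x} : Set V) ∧ WIn G C r v u}.ncard ≤ 2 * r + 1 := by
  have : {u | u ∈ ({x} : Set V) ∧ WIn G C r v u} ⊆ {x} := fun u hu => hu.1
  have := Set.ncard_le_ncard this (Set.toFinite _)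
  rw [Set.ncard_singleton] at this
  omega

theorem mainInd (hG : IsPlanar G) (r : ℕ) : ∀ n : ℕ, ∀ C : Set V, C.ncard ≤ n → Cn G C →
    (∃ ρ, Concl G r C ∅ ∅ ρ) ∧
    (∀ P, Cn G P → Disjoint P C → ∃ ρ, Concl G r C P ∅ ρ) ∧
    (∀ P Q, Cn G P → Cn G Q → Ad G P Q → Disjoint P Q → Disjoint P C → Disjoint Q C →
      ∃ ρ, Concl G r C P Q ρ) := by
  intro n
  induction n with
  | zero =>
    intro C hn hC
    have := (Set.ncard_pos (Set.toFinite _)).2 hC.1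
    omega
  | succ n ih =>
    intro C hn hC
    have IH : ∀ R : Set V, R.Nonempty → R ⊆ C → ∀ d ∈ C \ R, (comp G (C \ R) d).ncard ≤ n := by
      rintro R ⟨a, ha⟩ hRC d hd
      have h : comp G (C \ R) d ⊂ C :=
        LE.le.ssubset_of_mem_notMem (comp_sub.trans Set.sdiff_subset) (hRC ha)
          (fun hh => (comp_sub hh).2 ha)
      have := Set.ncard_lt_ncard h (Set.toFinite _)
      omega
    have dj : ∀ D : Set V, Disjoint (C \ D) D := fun D => Set.disjoint_sdiff_left
    have T0 : ∃ ρ, Concl G r C ∅ ∅ ρ := by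
      obtain ⟨x, hx⟩ := hC.1
      have hxC : {x} ⊆ C := by simpa using hx
      refine step hxC (singleton_count r x) fun d hd => ?_
      obtain ⟨ρ, hρ⟩ := (ih _ (IH {x} (Set.singleton_nonempty x) hxC d hd) (comp_cn hd)).2.1 _
        (rest_cn hC hxC (Cn.singleton x)) (dj _)
      refine ⟨ρ, Or.inl ⟨?_, hρ⟩⟩
      rintro ⟨_, _, v, hv, _⟩
      exact hv
    have T1 : ∀ P, Cn G P → Disjoint P C → ∃ ρ, Concl G r C P ∅ ρ := by
      intro P cP dP
      by_cases hCP : Ad G C P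
      · obtain ⟨x, hx, z, hz, hxz⟩ := hCP
        have hxC : {x} ⊆ C := by simpa using hx
        refine step hxC (singleton_count r x) fun d hd => ?_
        obtain ⟨ρ, hρ⟩ := (ih _ (IH {x} (Set.singleton_nonempty x) hxC d hd) (comp_cn hd)).2.2 _ P
          (rest_cn hC hxC (Cn.singleton x)) cP
          ⟨x, ⟨hx, fun hh => (comp_sub hh).2 rfl⟩, z, hz, hxz⟩
          (dP.symm.mono_left Set.sdiff_subset) (dj _)
          (dP.mono_right (comp_sub.trans Set.sdiff_subset))
        refine ⟨ρ, Or.inl ⟨?_, hρ⟩⟩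
        rintro ⟨_, _, v, hv, _⟩
        exact hv
      · obtain ⟨ρ, hρ⟩ := T0
        exact ⟨ρ, (hρ.ofNot hCP).symm⟩
    refine ⟨T0, T1, fun P Q cP cQ aPQ dPQ dPC dQC => ?_⟩
    by_cases hCP : Ad G C P
    swap
    · obtain ⟨ρ, hρ⟩ := T1 Q cQ dQC
      exact ⟨ρ, (hρ.ofNot hCP).symm⟩
    by_cases hCQ : Ad G C Q
    swap
    · obtain ⟨ρ, hρ⟩ := T1 P cP dPC
      exact ⟨ρ, hρ.ofNot hCQ⟩
    obtain ⟨x, hx, y, hy, hxy⟩ := pairLemma hG hC cP cQ aPQ dPQ dPC dQC hCP hCQ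
    obtain ⟨R, hRC, cR, hxR, hyR, hcount⟩ := geodesic r hC hx hy
    refine step hRC hcount fun d hd => ?_
    have hno := hxy R hRC cR hxR hyR (comp G (C \ R) d) (comp_sub.trans Set.sdiff_subset)
      (comp_cn hd) (Set.disjoint_left.2 fun u hu hh => (comp_sub hh).2 hu)
    have cPQ : Cn G (P ∪ Q) := cP.union cQ (Or.inr aPQ)
    have dPQC : Disjoint (P ∪ Q) C := Set.disjoint_union_left.2 ⟨dPC, dQC⟩
    have key : ∀ X ⊆ P ∪ Q, Ad G C X → ¬ Ad G (comp G (C \ R) d) X →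
        ∃ ρ, Concl G r (comp G (C \ R) d) (C \ comp G (C \ R) d) (P ∪ Q) ρ := by
      intro X hX hCX hDX
      refine (ih _ (IH _ cR.1 hRC d hd) (comp_cn hd)).2.2 _ (P ∪ Q)
        (rest_cn hC hRC cR) cPQ ?_ (dPQC.symm.mono_left Set.sdiff_subset) (dj _)
        (dPQC.mono_right (comp_sub.trans Set.sdiff_subset))
      obtain ⟨u, hu, v, hv, huv⟩ := hCX
      exact ⟨u, ⟨hu, fun hh => hDX ⟨u, hh, v, hv, huv⟩⟩, v, hX hv, huv⟩
    by_cases hDQ : Ad G (comp G (C \ R) d) Q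
    · have hDP : ¬ Ad G (comp G (C \ R) d) P := fun hh => hno hh hDQ
      obtain ⟨ρ, hρ⟩ := key P Set.subset_union_left hCP hDP
      exact ⟨ρ, Or.inr ⟨hDP, hρ.mono Set.subset_union_right⟩⟩
    · obtain ⟨ρ, hρ⟩ := key Q Set.subset_union_right hCQ hDQ
      exact ⟨ρ, Or.inl ⟨hDQ, hρ.mono Set.subset_union_left⟩⟩

theorem final (G : SimpleGraph V) (hG : IsPlanar G) (r : ℕ) :
    wcol G r ≤ (r + 2).choose 2 * (2 * r + 1) := by
  classical
  have h : ∀ D : Set V, ∃ ρ : V → ℕ, Cn G D → Concl G r D ∅ ∅ ρ := by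
    intro D
    by_cases hD : Cn G D
    · obtain ⟨ρ, hρ⟩ := (mainInd hG r _ D le_rfl hD).1
      exact ⟨ρ, fun _ => hρ⟩
    · exact ⟨fun _ => 0, fun hh => absurd hh hD⟩
  choose ρD hρD using h
  let ρ : V → ℕ := fun v => ρD (comp G Set.univ v) v
  let f : V → ℕ ×ₗ Fin (Fintype.card V) := fun v => toLex (ρ v, Fintype.equivFin V v)
  have hf : Function.Injective f := by
    intro a b hab
    have := congrArg (fun z => (ofLex z).2) hab
    simpa [f] using this
  let L : LinearOrder V := LinearOrder.lift' f hf
  have hL : ∀ u w, L.le u w → ρ u ≤ ρ w := by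
    intro u w huw
    have huw : f u ≤ f w := huw
    rw [Prod.Lex.le_iff] at huw
    rcases huw with h | h
    · exact le_of_lt h
    · exact le_of_eq h.1
  apply Nat.sInf_le
  refine ⟨L, fun v => ?_⟩
  have hvD : v ∈ comp G Set.univ v := mem_comp (Set.mem_univ v)
  have hc := hρD _ (comp_cn (G := G) (Set.mem_univ v)) v hvD 0 0 (Or.inl rfl) (Or.inl rfl)
  have hsub : WReach G L r v ⊆ WW G r (comp G Set.univ v) (ρD (comp G Set.univ v)) v := by
    rintro u ⟨p, _, hp, hp'⟩
    have hs : ∀ w ∈ p.support, w ∈ comp G Set.univ v := fun w hw =>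
      sub_comp (Set.subset_univ _) (support_cn p) p.start_mem_support hw
    refine ⟨p, hp, fun w hw => ⟨hs w hw, ?_⟩⟩
    have := hL u w (hp' w hw)
    simp only [ρ, comp_eq (hs w hw), comp_eq (hs u p.end_mem_support)] at this
    exact this
  have h1 := Set.ncard_le_ncard hsub (Set.toFinite _)
  rw [mul_comm]
  omega

end WC

/-- **Theorem.** Every planar graph satisfies
`wcol_r(G) ≤ C(r+2,2)·(2r+1)` for every `r ≥ 1`. -/
theorem wcol_le_of_planar (G : SimpleGraph V) (hplanar : IsPlanar G)
    (r : ℕ) (hr : 1 ≤ r) :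
    wcol G r ≤ (r + 2).choose 2 * (2 * r + 1) := by
  exact WC.final G hplanar r
end
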